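/- arXiv:math/0404084 — 5 statements merged into one kernel-verified Lean document; each statement's English description precedes it below -/
import Mathlib

section
/- Let Z be a random variable taking values in the positive integers on a probability space (Ω, F, P), and let (F_n)_{n≥0} be a filtration (an increasing sequence of sub-σ-fields of F). Define Y = Σ_{n=0}^∞ P(Z = n+1 | F_n). Then Y is dominated in the convex order by a mean-one exponential random variable: for every convex function φ : ℝ → ℝ, E[φ(Y)] ≤ ∫_0^∞ φ(x) e^{-x} dx, where both sides may be infinite. -/
open MeasureTheory Filter Set
open scoped ENNReal

theorem lintegral_tsum_tsub_le_measure {Ω : Type*} {m : MeasurableSpace Ω} {μ : Measure Ω}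
    (ℱ : Filtration ℕ m) {q : ℕ → Ω → ℝ≥0∞} (hq : ∀ k, Measurable[ℱ k] (q k))
    {D : ℕ → Set Ω} (hD : ∀ k, MeasurableSet (D k)) (hDd : Pairwise (Function.onFun Disjoint D))
    (hqD : ∀ k s, MeasurableSet[ℱ k] s → ∫⁻ ω in s, q k ω ∂μ = μ (s ∩ D k)) (t : ℝ≥0∞) :
    ∫⁻ ω, (∑' k, q k ω - t) ∂μ ≤ μ {ω | t < ∑' k, q k ω} := by
  set S : ℕ → Ω → ℝ≥0∞ := fun n ω => ∑ k ∈ Finset.range n, q k ω with hS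
  have hSmono : ∀ ω, Monotone fun n => S n ω := fun ω =>
    Finset.sum_mono_set_of_nonneg (fun _ => zero_le) |>.comp Finset.range_mono
  have hSmeas : ∀ n j, n ≤ j + 1 → Measurable[ℱ j] (S n) := by
    intro n j hnj
    refine Finset.measurable_fun_sum _ fun k hk => (hq k).mono (ℱ.mono ?_) le_rfl
    have := Finset.mem_range.1 hk
    omega
  set B : ℕ → Set Ω := fun n => {ω | S n ω ≤ t} ∩ {ω | t < S (n + 1) ω}
  have hBF : ∀ n, MeasurableSet[ℱ n] (B n) := fun n =>
    MeasurableSet.inter (hSmeas n n (by omega) measurableSet_Iic)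
      (hSmeas (n + 1) n le_rfl measurableSet_Ioi)
  have hBm : ∀ n, MeasurableSet (B n) := fun n => ℱ.le n _ (hBF n)
  have hBd : Pairwise (Function.onFun Disjoint B) := by
    refine (pairwise_disjoint_on B).2 fun i j hij => ?_
    refine Set.disjoint_left.2 fun ω hi hj => ?_
    exact absurd (hi.2.trans_le ((hSmono ω hij).trans hj.1)) (lt_irrefl _)
  have hqm : ∀ k, Measurable (q k) := fun k => (hq k).mono (ℱ.le k) le_rfl
  have hU : {ω | t < ∑' k, q k ω} = ⋃ n, B n := by
    ext ω
    simp only [mem_ofPred_eq, mem_iUnion]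
    constructor
    · intro h
      have hex : ∃ n, t < S n ω := by
        rwa [ENNReal.tsum_eq_iSup_nat, lt_iSup_iff] at h
      classical
      have hS0 : ¬ t < S 0 ω := by simp [hS]
      have hmin := fun n => Nat.find_min (m := n) hex
      have hspec := Nat.find_spec hex
      generalize Nat.find hex = N at hmin hspec
      cases N with
      | zero => exact absurd hspec hS0
      | succ n => exact ⟨n, not_lt.1 (hmin n (Nat.lt_succ_self n)), hspec⟩
    · rintro ⟨n, -, h⟩
      exact h.trans_le (ENNReal.sum_le_tsum _)
  have hsupp : ∫⁻ ω, (∑' k, q k ω - t) ∂μ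
      = ∫⁻ ω in {ω | t < ∑' k, q k ω}, (∑' k, q k ω - t) ∂μ := by
    refine (setLIntegral_eq_of_support_subset ?_).symm
    intro ω hω
    exact tsub_pos_iff_lt.1 (pos_iff_ne_zero.2 hω)
  rw [hsupp, hU, lintegral_iUnion hBm hBd, measure_iUnion hBd hBm]
  refine ENNReal.tsum_le_tsum fun n => ?_
  calc ∫⁻ ω in B n, (∑' k, q k ω - t) ∂μ
      ≤ ∫⁻ ω in B n, ∑' k, q (k + n) ω ∂μ := by
        refine setLIntegral_mono' (hBm n) fun ω hω => ?_
        have hsplit : S n ω + ∑' k, q (k + n) ω = ∑' k, q k ω :=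
          Summable.sum_add_tsum_nat_add' (f := fun k => q k ω) ENNReal.summable
        rw [tsub_le_iff_left, ← hsplit]
        gcongr
        exact hω.1
    _ = ∑' k, μ (B n ∩ D (k + n)) := by
        rw [lintegral_tsum fun k => (hqm _).aemeasurable]
        exact tsum_congr fun k => hqD _ _ (ℱ.mono (by omega) _ (hBF n))
    _ = μ (⋃ k, B n ∩ D (k + n)) := by
        have hdisj : Pairwise (Function.onFun Disjoint fun k => B n ∩ D (k + n)) := fun i j hij =>
          (hDd fun h => hij (Nat.add_right_cancel h)).mono inter_subset_right inter_subset_right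
        exact (measure_iUnion hdisj fun k => (hBm n).inter (hD _)).symm
    _ ≤ μ (B n) := measure_mono (iUnion_subset fun _ => inter_subset_left)

theorem lintegral_tsub_le_exp_neg {Ω : Type*} {m : MeasurableSpace Ω} {μ : Measure Ω}
    {W : Ω → ℝ≥0∞} (hW : Measurable W) (hW1 : ∫⁻ ω, W ω ∂μ ≤ 1)
    (h : ∀ t, ∫⁻ ω, (W ω - t) ∂μ ≤ μ {ω | t < W ω}) {t : ℝ} (ht : 0 ≤ t) :
    ∫⁻ ω, (W ω - ENNReal.ofReal t) ∂μ ≤ ENNReal.ofReal (Real.exp (-t)) := by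
  have step : ∀ s δ : ℝ≥0∞, (1 + δ) * ∫⁻ ω, (W ω - (s + δ)) ∂μ ≤ ∫⁻ ω, (W ω - s) ∂μ := by
    intro s δ
    have hm : MeasurableSet {ω | s + δ < W ω} := hW measurableSet_Ioi
    calc (1 + δ) * ∫⁻ ω, (W ω - (s + δ)) ∂μ
        ≤ ∫⁻ ω, (W ω - (s + δ)) ∂μ + δ * μ {ω | s + δ < W ω} := by
          rw [add_mul, one_mul]
          gcongr
          exact h _
      _ = ∫⁻ ω, ((W ω - (s + δ)) + {ω | s + δ < W ω}.indicator (fun _ => δ) ω) ∂μ := by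
          rw [lintegral_add_left (hW.sub_const _), lintegral_indicator_const hm]
      _ ≤ ∫⁻ ω, (W ω - s) ∂μ := by
          refine lintegral_mono fun ω => ?_
          by_cases hω : s + δ < W ω
          · simp only [indicator, mem_ofPred_eq, hω, if_true]
            rw [← tsub_tsub, tsub_add_cancel_of_le]
            exact ENNReal.le_sub_of_add_le_left (ne_top_of_lt (lt_of_le_of_lt le_self_add hω)) hω.le
          · simp [indicator, hω, tsub_eq_zero_of_le (not_lt.1 hω)]
  have iter : ∀ (δ : ℝ≥0∞) (n : ℕ), (1 + δ) ^ n * ∫⁻ ω, (W ω - n * δ) ∂μ ≤ 1 := by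
    intro δ n
    induction n with
    | zero => simpa using hW1
    | succ n ih =>
      refine le_trans ?_ ih
      rw [pow_succ, mul_assoc]
      gcongr
      simpa [add_mul] using step (n * δ) δ
  have hfin : ∫⁻ ω, (W ω - ENNReal.ofReal t) ∂μ ≠ ∞ :=
    ne_top_of_le_ne_top ENNReal.one_ne_top
      ((lintegral_mono fun _ => tsub_le_self).trans hW1)
  rw [ENNReal.le_ofReal_iff_toReal_le hfin (Real.exp_pos _).le, Real.exp_neg, ← one_div,
    le_div_iff₀ (Real.exp_pos _)]
  refine le_of_tendsto ((Real.tendsto_one_add_div_pow_exp t).const_mul _) ?_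
  filter_upwards [eventually_gt_atTop 0] with n hn
  have hn' : (n : ℝ) ≠ 0 := by positivity
  have h0 : 0 ≤ t / n := by positivity
  have key := iter (ENNReal.ofReal (t / n)) n
  have e1 : (n : ℝ≥0∞) * ENNReal.ofReal (t / n) = ENNReal.ofReal t := by
    rw [← ENNReal.ofReal_natCast, ← ENNReal.ofReal_mul (by positivity), mul_div_cancel₀ _ hn']
  rw [e1] at key
  have := ENNReal.toReal_mono ENNReal.one_ne_top key
  rw [ENNReal.toReal_mul, ENNReal.toReal_pow, ENNReal.toReal_add (by simp) (by simp),
    ENNReal.toReal_ofReal h0] at this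
  simpa [mul_comm] using this

theorem setLIntegral_ofReal_condExp_indicator {Ω : Type*} {m m₀ : MeasurableSpace Ω}
    {μ : Measure[m₀] Ω} [IsFiniteMeasure μ] (hm : m ≤ m₀) {A s : Set Ω} (hA : MeasurableSet[m₀] A)
    (hs : MeasurableSet[m] s) :
    ∫⁻ ω in s, ENNReal.ofReal ((μ[A.indicator (fun _ => (1 : ℝ)) | m]) ω) ∂μ = μ (s ∩ A) := by
  have hint : Integrable (A.indicator fun _ => (1 : ℝ)) μ := (integrable_const 1).indicator hA
  have hnn : 0 ≤ᵐ[μ] μ[A.indicator (fun _ => (1 : ℝ)) | m] :=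
    condExp_nonneg (Eventually.of_forall fun ω => indicator_nonneg (by simp) ω)
  rw [← ofReal_integral_eq_lintegral_ofReal integrable_condExp.integrableOn
    (ae_restrict_of_ae hnn), setIntegral_condExp hm hint hs, setIntegral_indicator hA]
  simp [Measure.real]

theorem hasDerivAt_neg_sub_add_one_mul_exp_neg (t x : ℝ) :
    HasDerivAt (fun x => -((x - t + 1) * Real.exp (-x))) ((x - t) * Real.exp (-x)) x := by
  have h1 : HasDerivAt (fun x : ℝ => x - t + 1) 1 x := ((hasDerivAt_id x).sub_const t).add_const 1
  have h2 : HasDerivAt (fun x : ℝ => Real.exp (-x)) (Real.exp (-x) * (-1)) x :=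
    (hasDerivAt_neg x).exp
  exact (h1.mul h2).neg.congr_deriv (by ring)

theorem tendsto_neg_sub_add_one_mul_exp_neg (t : ℝ) :
    Tendsto (fun x : ℝ => -((x - t + 1) * Real.exp (-x))) atTop (nhds 0) := by
  have h1 := Real.tendsto_pow_mul_exp_neg_atTop_nhds_zero 1
  have h0 := (Real.tendsto_pow_mul_exp_neg_atTop_nhds_zero 0).const_mul (1 - t)
  convert (h1.add h0).neg using 2
  · ring
  · simp

theorem integrableOn_sub_mul_exp_neg (t : ℝ) :
    IntegrableOn (fun x => (x - t) * Real.exp (-x)) (Ioi t) :=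
  integrableOn_Ioi_deriv_of_nonneg' (fun x _ => hasDerivAt_neg_sub_add_one_mul_exp_neg t x)
    (fun _ hx => mul_nonneg (sub_nonneg.2 (le_of_lt hx)) (Real.exp_pos _).le)
    (tendsto_neg_sub_add_one_mul_exp_neg t)

theorem integral_sub_mul_exp_neg (t : ℝ) :
    ∫ x in Ioi t, (x - t) * Real.exp (-x) = Real.exp (-t) := by
  rw [integral_Ioi_of_hasDerivAt_of_nonneg'
    (fun x _ => hasDerivAt_neg_sub_add_one_mul_exp_neg t x)
    (fun _ hx => mul_nonneg (sub_nonneg.2 (le_of_lt hx)) (Real.exp_pos _).le)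
    (tendsto_neg_sub_add_one_mul_exp_neg t)]
  simp

theorem ofReal_exp_neg_le_lintegral_hinge {t : ℝ} (ht : 0 ≤ t) :
    ENNReal.ofReal (Real.exp (-t))
      ≤ ∫⁻ x in Ioi (0 : ℝ), ENNReal.ofReal (x - t) * ENNReal.ofReal (Real.exp (-x)) := by
  rw [← integral_sub_mul_exp_neg t, ofReal_integral_eq_lintegral_ofReal
    (integrableOn_sub_mul_exp_neg t)
    ((ae_restrict_iff' measurableSet_Ioi).2 (Eventually.of_forall fun _ hx =>
      mul_nonneg (sub_nonneg.2 (le_of_lt hx)) (Real.exp_pos _).le))]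
  refine (lintegral_mono_set (Ioi_subset_Ioi ht)).trans (lintegral_mono fun x => ?_)
  rw [ENNReal.ofReal_mul' (Real.exp_pos _).le]

theorem lintegral_comp_add_mul_exp_neg_le (G : ℝ → ℝ≥0∞) {h : ℝ} (hh : 0 ≤ h) :
    ∫⁻ x in Ioi (0 : ℝ), G (x + h) * ENNReal.ofReal (Real.exp (-x))
      ≤ ENNReal.ofReal (Real.exp h)
        * ∫⁻ x in Ioi (0 : ℝ), G x * ENNReal.ofReal (Real.exp (-x)) := by
  rw [← lintegral_const_mul' _ _ ENNReal.ofReal_ne_top, ← lintegral_indicator measurableSet_Ioi,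
    ← lintegral_indicator measurableSet_Ioi,
    ← lintegral_add_right_eq_self (μ := volume) (indicator (Ioi (0 : ℝ)) fun x =>
      ENNReal.ofReal (Real.exp h) * (G x * ENNReal.ofReal (Real.exp (-x)))) h]
  refine lintegral_mono fun x => ?_
  by_cases hx : 0 < x
  · have hxh : 0 < x + h := by linarith
    simp only [indicator, mem_Ioi, hx, hxh, if_true]
    rw [mul_left_comm, ← ENNReal.ofReal_mul (Real.exp_pos _).le, ← Real.exp_add]
    simp
  · simp [indicator, hx]

theorem ConvexOn.exists_hinge_sum {ψ : ℝ → ℝ} (hψ : ConvexOn ℝ univ ψ) (h0 : ψ 0 = 0)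
    (hnn : ∀ x, 0 ≤ x → 0 ≤ ψ x) {h : ℝ} (hh : 0 < h) :
    ∃ c : ℕ → ℝ, ∀ x, 0 ≤ x →
      ENNReal.ofReal (ψ x) ≤ ∑' k : ℕ, ENNReal.ofReal (c k) * ENNReal.ofReal (x - k * h) ∧
      ∑' k : ℕ, ENNReal.ofReal (c k) * ENNReal.ofReal (x - k * h)
        ≤ ENNReal.ofReal (ψ (x + h)) := by
  have hmono : ∀ x y, 0 ≤ x → x ≤ y → ψ x ≤ ψ y := by
    intro x y hx hxy
    rcases hx.eq_or_lt with rfl | hx'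
    · rw [h0]; exact hnn _ hxy
    rcases hxy.eq_or_lt with rfl | hxy'
    · rfl
    have := hψ.slope_mono_adjacent (mem_univ 0) (mem_univ y) hx' hxy'
    rw [h0, sub_zero, sub_zero, le_div_iff₀ (by linarith)] at this
    have h2 : 0 ≤ ψ x / x * (y - x) :=
      mul_nonneg (div_nonneg (hnn x hx) hx) (by linarith)
    linarith
  set d : ℕ → ℝ := fun k => (ψ ((k + 1) * h) - ψ (k * h)) / h with hd
  have hdh : ∀ k : ℕ, d k * h = ψ ((k + 1) * h) - ψ (k * h) := fun k =>
    div_mul_cancel₀ _ hh.ne'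
  have hdm : ∀ k, d k ≤ d (k + 1) := by
    intro k
    have := hψ.slope_mono_adjacent (mem_univ (k * h)) (mem_univ ((k + 1 + 1) * h))
      (by nlinarith : (k : ℝ) * h < (k + 1) * h) (by nlinarith)
    simp only [hd]
    push_cast
    rw [show (((k : ℝ) + 1 + 1) * h - (k + 1) * h) = h by ring,
      show (((k : ℝ) + 1) * h - k * h) = h by ring] at this
    exact this
  have hd0 : ∀ k, 0 ≤ d k := by
    intro k
    refine div_nonneg (sub_nonneg.2 (hmono _ _ (by positivity) (by nlinarith))) hh.le
  let c : ℕ → ℝ := fun k => Nat.casesOn k (d 0) fun j => d (j + 1) - d j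
  have hc0 : ∀ k, 0 ≤ c k := by
    intro k
    cases k with
    | zero => exact hd0 0
    | succ k => exact sub_nonneg.2 (hdm k)
  have hsum : ∀ (n : ℕ) (x : ℝ), ∑ k ∈ Finset.range (n + 1), c k * (x - k * h)
      = ψ (n * h) + (x - n * h) * d n := by
    intro n x
    induction n with
    | zero => simp [h0, c, mul_comm]
    | succ n ih =>
      rw [Finset.sum_range_succ, ih]
      have := hdh n
      simp only [c]
      push_cast
      linear_combination this
  refine ⟨c, fun x hx => ?_⟩
  set n := ⌊x / h⌋₊
  have hnx : n * h ≤ x := (le_div_iff₀ hh).1 (Nat.floor_le (by positivity))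
  have hxn : x < (n + 1) * h := (div_lt_iff₀ hh).1 (Nat.lt_floor_add_one _)
  have htsum : ∑' k : ℕ, ENNReal.ofReal (c k) * ENNReal.ofReal (x - k * h)
      = ENNReal.ofReal (ψ (n * h) + (x - n * h) * d n) := by
    rw [tsum_eq_sum (s := Finset.range (n + 1)), ← hsum, ENNReal.ofReal_sum_of_nonneg]
    · exact Finset.sum_congr rfl fun k _ => (ENNReal.ofReal_mul (hc0 k)).symm
    · intro k hk
      have : (k : ℝ) ≤ n := by exact_mod_cast Nat.lt_succ_iff.1 (Finset.mem_range.1 hk)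
      exact mul_nonneg (hc0 k) (by nlinarith)
    · intro k hk
      have : (n : ℝ) + 1 ≤ k := by
        exact_mod_cast not_lt.1 fun h' => hk (Finset.mem_range.2 h')
      rw [ENNReal.ofReal_of_nonpos (p := x - k * h) (by nlinarith), mul_zero]
  rw [htsum]
  constructor
  · refine ENNReal.ofReal_le_ofReal ?_
    rcases hnx.eq_or_lt with he | hlt
    · rw [← he]; simp
    have := hψ.slope_mono_adjacent (mem_univ (n * h)) (mem_univ ((n + 1) * h)) hlt hxn
    rw [div_le_div_iff₀ (by linarith) (by linarith)] at this
    have hd' := hdh n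
    have e : (ψ x - ψ (n * h)) * h ≤ (x - n * h) * d n * h := by
      rw [mul_assoc, hd']
      linarith
    have := le_of_mul_le_mul_right e hh
    linarith
  · refine ENNReal.ofReal_le_ofReal ?_
    have hd' := hdh n
    have h1 : (x - n * h) * d n ≤ h * d n :=
      mul_le_mul_of_nonneg_right (by linarith) (hd0 n)
    have h2 := hmono ((n + 1) * h) (x + h) (by positivity) (by linarith)
    linarith

theorem ConvexOn.lintegral_comp_le_lintegral_exp {Ω : Type*} {m : MeasurableSpace Ω}
    {μ : Measure Ω} {Y : Ω → ℝ} (hYm : AEMeasurable Y μ) (hY0 : ∀ ω, 0 ≤ Y ω)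
    (hY : ∀ t : ℝ, 0 ≤ t →
      ∫⁻ ω, ENNReal.ofReal (Y ω - t) ∂μ ≤ ENNReal.ofReal (Real.exp (-t)))
    {ψ : ℝ → ℝ} (hψ : ConvexOn ℝ univ ψ) (h0 : ψ 0 = 0) (hnn : ∀ x, 0 ≤ x → 0 ≤ ψ x) :
    ∫⁻ ω, ENNReal.ofReal (ψ (Y ω)) ∂μ
      ≤ ∫⁻ x in Ioi (0 : ℝ), ENNReal.ofReal (ψ x) * ENNReal.ofReal (Real.exp (-x)) := by
  set I := ∫⁻ x in Ioi (0 : ℝ), ENNReal.ofReal (ψ x) * ENNReal.ofReal (Real.exp (-x))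
  have key : ∀ h : ℝ, 0 < h →
      ∫⁻ ω, ENNReal.ofReal (ψ (Y ω)) ∂μ ≤ ENNReal.ofReal (Real.exp h) * I := by
    intro h hh
    obtain ⟨c, hc⟩ := hψ.exists_hinge_sum h0 hnn hh
    calc ∫⁻ ω, ENNReal.ofReal (ψ (Y ω)) ∂μ
        ≤ ∫⁻ ω, ∑' k : ℕ, ENNReal.ofReal (c k) * ENNReal.ofReal (Y ω - k * h) ∂μ :=
          lintegral_mono fun ω => (hc _ (hY0 ω)).1
      _ = ∑' k : ℕ, ENNReal.ofReal (c k) * ∫⁻ ω, ENNReal.ofReal (Y ω - k * h) ∂μ := by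
          rw [lintegral_tsum fun k => ((hYm.sub_const _).ennreal_ofReal.const_mul _)]
          exact tsum_congr fun k => lintegral_const_mul' _ _ ENNReal.ofReal_ne_top
      _ ≤ ∑' k : ℕ, ENNReal.ofReal (c k) * ∫⁻ x in Ioi (0 : ℝ),
            ENNReal.ofReal (x - k * h) * ENNReal.ofReal (Real.exp (-x)) := by
          gcongr with k
          exact (hY _ (by positivity)).trans (ofReal_exp_neg_le_lintegral_hinge (by positivity))
      _ = ∫⁻ x in Ioi (0 : ℝ), (∑' k : ℕ, ENNReal.ofReal (c k) * ENNReal.ofReal (x - k * h))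
            * ENNReal.ofReal (Real.exp (-x)) := by
          simp_rw [← ENNReal.tsum_mul_right, mul_assoc]
          rw [lintegral_tsum fun k => by fun_prop]
          exact tsum_congr fun k => (lintegral_const_mul' _ _ ENNReal.ofReal_ne_top).symm
      _ ≤ ∫⁻ x in Ioi (0 : ℝ), ENNReal.ofReal (ψ (x + h)) * ENNReal.ofReal (Real.exp (-x)) := by
          refine setLIntegral_mono' measurableSet_Ioi fun x hx => ?_
          gcongr
          exact (hc x (le_of_lt hx)).2
      _ ≤ ENNReal.ofReal (Real.exp h) * I :=
          lintegral_comp_add_mul_exp_neg_le (fun x => ENNReal.ofReal (ψ x)) hh.le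
  rcases eq_or_ne I ∞ with hI' | hI'
  · rw [hI']; exact le_top
  have hlim : Tendsto (fun h : ℝ => ENNReal.ofReal (Real.exp h) * I) (nhdsWithin 0 (Ioi 0))
      (nhds (ENNReal.ofReal (Real.exp 0) * I)) := by
    refine ENNReal.Tendsto.mul_const (Tendsto.mono_left ?_ nhdsWithin_le_nhds) (Or.inr hI')
    exact (ENNReal.continuous_ofReal.comp Real.continuous_exp).tendsto 0
  have := ge_of_tendsto hlim (eventually_mem_nhdsWithin.mono key)
  simpa using this

theorem lintegral_pos_add_neg_le_of_integral_le {α β : Type*} {mα : MeasurableSpace α}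
    {mβ : MeasurableSpace β} {μ : Measure α} {ν : Measure β} {f : α → ℝ} {g : β → ℝ}
    (hf : Integrable f μ) (hg : Integrable g ν) (h : ∫ x, f x ∂μ ≤ ∫ x, g x ∂ν) :
    (∫⁻ x, ENNReal.ofReal (f x) ∂μ) + (∫⁻ x, ENNReal.ofReal (-g x) ∂ν)
      ≤ (∫⁻ x, ENNReal.ofReal (g x) ∂ν) + (∫⁻ x, ENNReal.ofReal (-f x) ∂μ) := by
  rw [integral_eq_lintegral_pos_part_sub_lintegral_neg_part hf,
    integral_eq_lintegral_pos_part_sub_lintegral_neg_part hg] at h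
  have hf1 := hf.lintegral_lt_top.ne
  have hf2 := hf.neg.lintegral_lt_top.ne
  have hg1 := hg.lintegral_lt_top.ne
  have hg2 := hg.neg.lintegral_lt_top.ne
  simp only [Pi.neg_apply] at hf2 hg2
  rw [← ENNReal.toReal_le_toReal (ENNReal.add_ne_top.2 ⟨hf1, hg2⟩)
    (ENNReal.add_ne_top.2 ⟨hg1, hf2⟩), ENNReal.toReal_add hf1 hg2, ENNReal.toReal_add hg1 hf2]
  linarith

theorem ConvexOn.lintegral_le_lintegral_exp_of_hinge {Ω : Type*} {m : MeasurableSpace Ω}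
    {μ : Measure Ω} [IsProbabilityMeasure μ] {Y : Ω → ℝ} (hYm : Measurable Y)
    (hY0 : ∀ ω, 0 ≤ Y ω) (hYi : Integrable Y μ) (hY1 : ∫ ω, Y ω ∂μ = 1)
    (hY : ∀ t : ℝ, 0 ≤ t →
      ∫⁻ ω, ENNReal.ofReal (Y ω - t) ∂μ ≤ ENNReal.ofReal (Real.exp (-t)))
    {φ : ℝ → ℝ} (hφ : ConvexOn ℝ univ φ) :
    (∫⁻ ω, ENNReal.ofReal (φ (Y ω)) ∂μ)
        + (∫⁻ x in Ioi (0 : ℝ), ENNReal.ofReal (-(φ x * Real.exp (-x))))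
      ≤ (∫⁻ x in Ioi (0 : ℝ), ENNReal.ofReal (φ x * Real.exp (-x)))
        + (∫⁻ ω, ENNReal.ofReal (-(φ (Y ω))) ∂μ) := by
  set a := φ 0 - φ (-1) with ha
  set b := φ 0 with hb
  set ψ : ℝ → ℝ := fun x => φ x - (b + a * x) with hψdef
  have hψ0 : ψ 0 = 0 := by simp [hψdef, hb]
  have hψc : ConvexOn ℝ univ ψ := by
    refine ⟨convex_univ, fun x _ y _ s t hs ht hst => ?_⟩
    have := hφ.2 (mem_univ x) (mem_univ y) hs ht hst
    simp only [hψdef, smul_eq_mul] at this ⊢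
    linear_combination this + b * hst
  have hψnn : ∀ x, 0 ≤ x → 0 ≤ ψ x := by
    intro x hx
    rcases hx.eq_or_lt with rfl | hx
    · exact hψ0.ge
    have := hφ.slope_mono_adjacent (mem_univ (-1)) (mem_univ x) (by norm_num : (-1 : ℝ) < 0) hx
    rw [le_div_iff₀ (by linarith)] at this
    simp only [hψdef, ha, hb]
    norm_num at this
    linarith
  have hφm : Measurable φ :=
    (continuousOn_univ.1 (hφ.continuousOn isOpen_univ)).measurable
  have hψm : Measurable ψ := by fun_prop
  have hx0 : IntegrableOn (fun x => x * Real.exp (-x)) (Ioi (0 : ℝ)) := by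
    simpa using integrableOn_sub_mul_exp_neg 0
  have hx1 : ∫ x in Ioi (0 : ℝ), x * Real.exp (-x) = 1 := by
    simpa using integral_sub_mul_exp_neg 0
  rcases eq_or_ne (∫⁻ x in Ioi (0 : ℝ), ENNReal.ofReal (φ x * Real.exp (-x))) ∞ with hB | hB
  · rw [hB, top_add]; exact le_top
  have hψle := hψc.lintegral_comp_le_lintegral_exp hYm.aemeasurable hY0 hY hψ0 hψnn
  simp_rw [← ENNReal.ofReal_mul' (Real.exp_pos _).le] at hψle
  have haff : IntegrableOn (fun x => (b + a * x) * Real.exp (-x)) (Ioi (0 : ℝ)) := by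
    refine (((integrableOn_exp_neg_Ioi 0).const_mul b).add (hx0.const_mul a)).congr
      (Eventually.of_forall fun x => ?_)
    simp only [Pi.add_apply]
    ring
  have haff1 : ∫ x in Ioi (0 : ℝ), (b + a * x) * Real.exp (-x) = b + a := by
    have : ∀ x, (b + a * x) * Real.exp (-x) = b * Real.exp (-x) + a * (x * Real.exp (-x)) :=
      fun x => by ring
    simp_rw [this]
    rw [integral_add ((integrableOn_exp_neg_Ioi 0).const_mul b) (hx0.const_mul a),
      integral_const_mul, integral_const_mul, hx1, integral_exp_neg_Ioi_zero]
    ring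
  have hψE0 : 0 ≤ᵐ[volume.restrict (Ioi (0 : ℝ))] fun x => ψ x * Real.exp (-x) :=
    (ae_restrict_iff' measurableSet_Ioi).2 (Eventually.of_forall fun x hx =>
      mul_nonneg (hψnn x (le_of_lt hx)) (Real.exp_pos _).le)
  have hψfin : ∫⁻ x in Ioi (0 : ℝ), ENNReal.ofReal (ψ x * Real.exp (-x)) ≠ ∞ := by
    refine ne_top_of_le_ne_top (ENNReal.add_ne_top.2 ⟨hB, haff.neg.lintegral_lt_top.ne⟩) ?_
    rw [← lintegral_add_left (by fun_prop)]
    refine lintegral_mono fun x => ?_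
    refine le_trans (le_of_eq ?_) ENNReal.ofReal_add_le
    congr 1
    simp only [hψdef, Pi.neg_apply]
    ring
  have hψE : IntegrableOn (fun x => ψ x * Real.exp (-x)) (Ioi (0 : ℝ)) :=
    (lintegral_ofReal_ne_top_iff_integrable (by fun_prop) hψE0).1 hψfin
  have hψY : Integrable (fun ω => ψ (Y ω)) μ :=
    (lintegral_ofReal_ne_top_iff_integrable (hψm.comp hYm).aestronglyMeasurable
      (Eventually.of_forall fun ω => hψnn _ (hY0 ω))).1 (ne_top_of_le_ne_top hψfin hψle)
  have hint : ∫ ω, ψ (Y ω) ∂μ ≤ ∫ x in Ioi (0 : ℝ), ψ x * Real.exp (-x) := by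
    rw [← ENNReal.ofReal_le_ofReal_iff (integral_nonneg_of_ae hψE0),
      ofReal_integral_eq_lintegral_ofReal hψE hψE0, ofReal_integral_eq_lintegral_ofReal hψY
      (Eventually.of_forall fun ω => hψnn _ (hY0 ω))]
    exact hψle
  have haffY : Integrable (fun ω => b + a * Y ω) μ := (integrable_const b).add (hYi.const_mul a)
  have haffY1 : ∫ ω, (b + a * Y ω) ∂μ = b + a := by
    rw [integral_add (integrable_const b) (hYi.const_mul a), integral_const_mul, hY1]
    simp
  have e1 : (fun ω => φ (Y ω)) = fun ω => ψ (Y ω) + (b + a * Y ω) := by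
    ext ω; simp [hψdef]
  have e2 : (fun x => φ x * Real.exp (-x))
      = fun x => ψ x * Real.exp (-x) + (b + a * x) * Real.exp (-x) := by
    ext x; simp only [hψdef]; ring
  refine lintegral_pos_add_neg_le_of_integral_le (f := fun ω => φ (Y ω))
    (g := fun x => φ x * Real.exp (-x)) ?_ ?_ ?_
  · rw [e1]; exact hψY.add haffY
  · rw [e2]; exact hψE.add haff
  · rw [e1, e2, integral_add hψY haffY, integral_add hψE haff, haffY1, haff1]
    linarith

/-- **Maximum variation of total risk, discrete case.**
Let `Z` be a random positive integer and `ℱ` a filtration.  Let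
`Y = ∑_{n=0}^∞ P(Z = n+1 | ℱ n)`.  Then `Y` is dominated in the convex order by a
mean-one exponential random variable: for every convex `φ : ℝ → ℝ`,
`E[φ(Y)] ≤ ∫_0^∞ φ(x) e^{-x} dx`, where both sides may be infinite.  The inequality of
possibly-infinite expectations `E[f] ≤ E[g]` is encoded as
`E[f⁺] + E[g⁻] ≤ E[g⁺] + E[f⁻]` using lower Lebesgue integrals. -/
theorem total_risk_discrete_convex_order
    {Ω : Type*} {m : MeasurableSpace Ω} (μ : Measure Ω) [IsProbabilityMeasure μ]
    (ℱ : Filtration ℕ m) (Z : Ω → ℕ) (hZmeas : Measurable Z) (hZpos : ∀ ω, 0 < Z ω)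
    (Y : Ω → ℝ)
    (hY : Y = fun ω =>
      ∑' n : ℕ, (μ[Set.indicator {ω' | Z ω' = n + 1} (fun _ => (1 : ℝ)) | ℱ n]) ω) :
    ∀ φ : ℝ → ℝ, ConvexOn ℝ Set.univ φ →
      (∫⁻ ω, ENNReal.ofReal (φ (Y ω)) ∂μ)
          + (∫⁻ x in Set.Ioi (0 : ℝ), ENNReal.ofReal (-(φ x * Real.exp (-x))))
        ≤ (∫⁻ x in Set.Ioi (0 : ℝ), ENNReal.ofReal (φ x * Real.exp (-x)))
          + (∫⁻ ω, ENNReal.ofReal (-(φ (Y ω))) ∂μ) := by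
  intro φ hφ
  set D : ℕ → Set Ω := fun k => {ω | Z ω = k + 1}
  have hD : ∀ k, MeasurableSet (D k) := fun k => hZmeas (measurableSet_singleton (k + 1))
  have hDd : Pairwise (Function.onFun Disjoint D) := fun i j hij =>
    Set.disjoint_left.2 fun ω hi hj => hij (Nat.succ_injective (Eq.trans (Eq.symm hi) hj))
  have hDU : ⋃ k, D k = univ := by
    refine eq_univ_of_forall fun ω => mem_iUnion.2 ⟨Z ω - 1, ?_⟩
    exact (Nat.sub_add_cancel (hZpos ω)).symm
  set p : ℕ → Ω → ℝ := fun k => μ[(D k).indicator (fun _ => (1 : ℝ)) | ℱ k]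
  set q : ℕ → Ω → ℝ≥0∞ := fun k ω => ENNReal.ofReal (p k ω)
  have hqF : ∀ k, Measurable[ℱ k] (q k) := fun k =>
    ENNReal.measurable_ofReal.comp stronglyMeasurable_condExp.measurable
  have hqm : ∀ k, Measurable (q k) := fun k => (hqF k).mono (ℱ.le k) le_rfl
  have hqD : ∀ k s, MeasurableSet[ℱ k] s → ∫⁻ ω in s, q k ω ∂μ = μ (s ∩ D k) := fun k s hs =>
    setLIntegral_ofReal_condExp_indicator (ℱ.le k) (hD k) hs
  set W : Ω → ℝ≥0∞ := fun ω => ∑' k, q k ω with hW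
  have hWm : Measurable W := Measurable.tsum hqm
  have hW1 : ∫⁻ ω, W ω ∂μ = 1 := by
    rw [lintegral_tsum fun k => (hqm k).aemeasurable]
    have : ∀ k, ∫⁻ ω, q k ω ∂μ = μ (D k) := fun k => by
      simpa using hqD k univ MeasurableSet.univ
    simp_rw [this]
    rw [← measure_iUnion hDd hD, hDU, measure_univ]
  have hWfin : ∀ᵐ ω ∂μ, W ω < ∞ := ae_lt_top hWm (by simp [hW1])
  have hpnn : ∀ᵐ ω ∂μ, ∀ k, 0 ≤ p k ω := ae_all_iff.2 fun k =>
    condExp_nonneg (Eventually.of_forall fun ω => indicator_nonneg (by simp) ω)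
  have hYW : Y =ᵐ[μ] fun ω => (W ω).toReal := by
    filter_upwards [hpnn] with ω hω
    rw [hY, hW, ENNReal.tsum_toReal_eq fun k => ENNReal.ofReal_ne_top]
    exact tsum_congr fun k => (ENNReal.toReal_ofReal (hω k)).symm
  have hhinge : ∀ t : ℝ, 0 ≤ t →
      ∫⁻ ω, ENNReal.ofReal ((W ω).toReal - t) ∂μ ≤ ENNReal.ofReal (Real.exp (-t)) := by
    intro t ht
    refine le_trans (le_of_eq (lintegral_congr_ae ?_)) (lintegral_tsub_le_exp_neg hWm hW1.le
      (lintegral_tsum_tsub_le_measure ℱ hqF hD hDd hqD) ht)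
    filter_upwards [hWfin] with ω hω
    rw [ENNReal.ofReal_sub _ ht, ENNReal.ofReal_toReal hω.ne]
  have key := ConvexOn.lintegral_le_lintegral_exp_of_hinge hWm.ennreal_toReal
    (fun ω => ENNReal.toReal_nonneg) (integrable_toReal_of_lintegral_ne_top hWm.aemeasurable
      (by simp [hW1])) (by rw [integral_toReal hWm.aemeasurable hWfin, hW1]; simp) hhinge hφ
  have hcongr : ∀ f : ℝ → ℝ≥0∞, ∫⁻ ω, f (Y ω) ∂μ = ∫⁻ ω, f (W ω).toReal ∂μ := fun f =>
    lintegral_congr_ae (hYW.fun_comp f)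
  rw [hcongr fun y => ENNReal.ofReal (φ y), hcongr fun y => ENNReal.ofReal (-φ y)]
  exact key
end

section
/- Let (F_n)_{n≥0} be a filtration on a probability space (Ω, F, P), and let (A_n)_{n≥0} be an adapted process with A_0 = 0, with A_n nondecreasing in n, 0 ≤ A_n ≤ 1 for all n, and A_n → 1 almost surely as n → ∞. Set R = Σ_{n=1}^∞ E[A_n − A_{n−1} | F_{n−1}]. Then E[R] = 1 and, for every real λ > 0, E[(R − λ)^+] ≤ e^{-λ}. -/
open MeasureTheory Filter Set
open scoped ENNReal

/-- One-step comparison for the potential `y * exp (-s⁺) + s⁻`. -/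
lemma stop_loss_potential_step {r y s : ℝ} (hr : 0 ≤ r) (hry : r ≤ y) (hy : y ≤ 1) :
    (y - r) * Real.exp (-max (s - r) 0) + max (r - s) 0
      ≤ y * Real.exp (-max s 0) + max (-s) 0 := by
  have hy0 : 0 ≤ y := hr.trans hry
  have key : ∀ t : ℝ, 0 ≤ t → y - t ≤ y * Real.exp (-t) := fun t ht => by
    nlinarith [Real.add_one_le_exp (-t)]
  rcases le_total r s with hrs | hrs
  · rw [max_eq_left (sub_nonneg.2 hrs), max_eq_right (sub_nonpos.2 hrs),
      max_eq_left (hr.trans hrs), max_eq_right (neg_nonpos.2 (hr.trans hrs)), add_zero, add_zero]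
    calc (y - r) * Real.exp (-(s - r)) ≤ y * Real.exp (-r) * Real.exp (-(s - r)) := by
          gcongr; exact key r hr
      _ = y * Real.exp (-s) := by rw [mul_assoc, ← Real.exp_add]; ring_nf
  · rw [max_eq_right (sub_nonpos.2 hrs), max_eq_left (sub_nonneg.2 hrs), neg_zero, Real.exp_zero]
    rcases le_total 0 s with hs | hs
    · rw [max_eq_left hs, max_eq_right (neg_nonpos.2 hs)]
      linarith [key s hs]
    · rw [max_eq_right hs, max_eq_left (neg_nonneg.2 hs), neg_zero, Real.exp_zero]
      linarith

section Compensator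

variable {Ω : Type*} {m : MeasurableSpace Ω} {μ : Measure Ω}
  {ℱ : Filtration ℕ m} {A : ℕ → Ω → ℝ}

lemma condExp_increment_nonneg (hmono : ∀ ω, Monotone fun n => A n ω) (n : ℕ) :
    ∀ᵐ ω ∂μ, 0 ≤ (μ[A (n + 1) - A n | ℱ n]) ω :=
  condExp_nonneg (ae_of_all _ fun ω => sub_nonneg.2 (hmono ω n.le_succ))

/-- Partial sums of the compensator form a predictable process. -/
lemma measurable_compensator_partial_sum (n k : ℕ) (hnk : n ≤ k + 1) :
    Measurable[ℱ k] fun ω => ∑ i ∈ Finset.range n, (μ[A (i + 1) - A i | ℱ i]) ω := by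
  refine Finset.measurable_fun_sum _ fun i hi => ?_
  exact (stronglyMeasurable_condExp.measurable).mono
    (ℱ.mono (by have := Finset.mem_range.1 hi; omega)) le_rfl

lemma integrable_compensator_partial_sum (n : ℕ) :
    Integrable (fun ω => ∑ i ∈ Finset.range n, (μ[A (i + 1) - A i | ℱ i]) ω) μ :=
  integrable_finsetSum _ fun _ _ => integrable_condExp

lemma integrable_stop_loss_weight (l : ℝ) (n : ℕ) {Y : Ω → ℝ} (hY : Integrable Y μ) :
    Integrable (fun ω => Y ω * Real.exp
      (-max (l - ∑ i ∈ Finset.range n, (μ[A (i + 1) - A i | ℱ i]) ω) 0)) μ := by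
  refine hY.mul_bdd (c := 1) ?_ (ae_of_all _ fun ω => ?_)
  · exact (((measurable_const.sub ((measurable_compensator_partial_sum n n n.le_succ).mono
      (ℱ.le n) le_rfl)).max measurable_const).neg.exp).aestronglyMeasurable
  · rw [Real.norm_eq_abs, Real.abs_exp, Real.exp_le_one_iff]
    exact neg_nonpos.2 (le_max_right _ _)

variable [IsProbabilityMeasure μ]

lemma integrable_of_adapted_of_mem_unit_interval (hA : Adapted ℱ A)
    (hbdd : ∀ n ω, 0 ≤ A n ω ∧ A n ω ≤ 1) (n : ℕ) : Integrable (A n) μ := by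
  refine Integrable.of_bound (C := 1)
    ((hA n).mono (ℱ.le n) le_rfl).aestronglyMeasurable (ae_of_all _ fun ω => ?_)
  rw [Real.norm_eq_abs, abs_of_nonneg (hbdd n ω).1]
  exact (hbdd n ω).2

lemma condExp_increment_le_one_sub (hA : Adapted ℱ A)
    (hbdd : ∀ n ω, 0 ≤ A n ω ∧ A n ω ≤ 1) (n : ℕ) :
    ∀ᵐ ω ∂μ, (μ[A (n + 1) - A n | ℱ n]) ω ≤ 1 - A n ω := by
  have hi := integrable_of_adapted_of_mem_unit_interval (μ := μ) hA hbdd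
  have hi' : Integrable (fun ω => 1 - A n ω) μ := (integrable_const 1).sub (hi n)
  have hY : μ[fun ω => 1 - A n ω | ℱ n] = fun ω => 1 - A n ω :=
    condExp_of_stronglyMeasurable (ℱ.le n) (measurable_const.sub (hA n)).stronglyMeasurable hi'
  have h := condExp_mono (m := ℱ n) ((hi (n + 1)).sub (hi n)) hi'
    (ae_of_all _ fun ω => sub_le_sub_right (hbdd (n + 1) ω).2 _)
  rwa [hY] at h

lemma integral_mul_stop_loss_weight_succ (hA : Adapted ℱ A)
    (hbdd : ∀ n ω, 0 ≤ A n ω ∧ A n ω ≤ 1) (l : ℝ) (n : ℕ) :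
    ∫ ω, (A (n + 1) - A n) ω * Real.exp
      (-max (l - ∑ i ∈ Finset.range (n + 1), (μ[A (i + 1) - A i | ℱ i]) ω) 0) ∂μ =
    ∫ ω, (μ[A (n + 1) - A n | ℱ n]) ω * Real.exp
      (-max (l - ∑ i ∈ Finset.range (n + 1), (μ[A (i + 1) - A i | ℱ i]) ω) 0) ∂μ := by
  have hi := integrable_of_adapted_of_mem_unit_interval (μ := μ) hA hbdd
  have hd := (hi (n + 1)).sub (hi n)
  have hc : StronglyMeasurable[ℱ n] fun ω => Real.exp
      (-max (l - ∑ i ∈ Finset.range (n + 1), (μ[A (i + 1) - A i | ℱ i]) ω) 0) :=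
    ((measurable_const.sub (measurable_compensator_partial_sum (n + 1) n le_rfl)).max
      measurable_const).neg.exp.stronglyMeasurable
  have h := condExp_mul_of_stronglyMeasurable_right hc
    (integrable_stop_loss_weight (μ := μ) (ℱ := ℱ) (A := A) l (n + 1) hd) hd
  rw [← integral_condExp (ℱ.le n)]
  exact integral_congr_ae h

/-- The potential `(1 - Aₙ) * exp (-(l - Rₙ)⁺) + (Rₙ - l)⁺` has expectation at most `exp (-l)`. -/
lemma integral_stop_loss_potential_le (hA : Adapted ℱ A) (hA0 : ∀ ω, A 0 ω = 0)
    (hmono : ∀ ω, Monotone fun n => A n ω) (hbdd : ∀ n ω, 0 ≤ A n ω ∧ A n ω ≤ 1)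
    {l : ℝ} (hl : 0 ≤ l) (n : ℕ) :
    ∫ ω, ((1 - A n ω) * Real.exp
        (-max (l - ∑ i ∈ Finset.range n, (μ[A (i + 1) - A i | ℱ i]) ω) 0) +
      max (∑ i ∈ Finset.range n, (μ[A (i + 1) - A i | ℱ i]) ω - l) 0) ∂μ ≤ Real.exp (-l) := by
  have hi := integrable_of_adapted_of_mem_unit_interval (μ := μ) hA hbdd
  have hY : ∀ k, Integrable (fun ω => 1 - A k ω) μ := fun k => (integrable_const 1).sub (hi k)
  have hpos : ∀ k, Integrable (fun ω =>
      max (∑ i ∈ Finset.range k, (μ[A (i + 1) - A i | ℱ i]) ω - l) 0) μ := fun k =>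
    ((integrable_compensator_partial_sum k).sub (integrable_const l)).pos_part
  induction n with
  | zero => simp [hA0, hl]
  | succ n ih =>
    refine le_trans ?_ ih
    have hW := fun k {Y : Ω → ℝ} (h : Integrable Y μ) =>
      integrable_stop_loss_weight (μ := μ) (ℱ := ℱ) (A := A) l k h
    have hd := (hi (n + 1)).sub (hi n)
    have hr : Integrable (μ[A (n + 1) - A n | ℱ n]) μ := integrable_condExp
    have hYr : Integrable (fun ω => 1 - A n ω - (μ[A (n + 1) - A n | ℱ n]) ω) μ := (hY n).sub hr
    have hsplit : ∫ ω, (1 - A (n + 1) ω) * Real.exp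
        (-max (l - ∑ i ∈ Finset.range (n + 1), (μ[A (i + 1) - A i | ℱ i]) ω) 0) ∂μ =
        ∫ ω, (1 - A n ω - (μ[A (n + 1) - A n | ℱ n]) ω) * Real.exp
        (-max (l - ∑ i ∈ Finset.range (n + 1), (μ[A (i + 1) - A i | ℱ i]) ω) 0) ∂μ := by
      have h := integral_mul_stop_loss_weight_succ (μ := μ) hA hbdd l n
      simp_rw [sub_mul (1 - A n _)]
      rw [integral_sub (hW (n + 1) (hY n)) (hW (n + 1) hr), ← h,
        ← integral_sub (hW (n + 1) (hY n)) (hW (n + 1) hd)]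
      congr 1 with ω
      simp only [Pi.sub_apply]
      ring
    rw [integral_add (hW (n + 1) (hY (n + 1))) (hpos (n + 1)), hsplit,
      ← integral_add (hW (n + 1) hYr) (hpos (n + 1))]
    refine integral_mono_ae ((hW (n + 1) hYr).add (hpos (n + 1)))
      ((hW n (hY n)).add (hpos n)) ?_
    filter_upwards [condExp_increment_nonneg (μ := μ) (ℱ := ℱ) hmono n,
      condExp_increment_le_one_sub (μ := μ) hA hbdd n] with ω h0 h1
    have h := stop_loss_potential_step
      (s := l - ∑ i ∈ Finset.range n, (μ[A (i + 1) - A i | ℱ i]) ω) h0 h1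
      (by linarith [(hbdd n ω).1])
    rw [sub_sub l, sub_sub_eq_add_sub, neg_sub] at h
    simpa only [Finset.sum_range_succ, add_comm] using h

lemma lintegral_stop_loss_partial_sum_le (hA : Adapted ℱ A) (hA0 : ∀ ω, A 0 ω = 0)
    (hmono : ∀ ω, Monotone fun n => A n ω) (hbdd : ∀ n ω, 0 ≤ A n ω ∧ A n ω ≤ 1)
    {l : ℝ} (hl : 0 ≤ l) (n : ℕ) :
    ∫⁻ ω, ENNReal.ofReal
        (max (∑ i ∈ Finset.range n, (μ[A (i + 1) - A i | ℱ i]) ω - l) 0) ∂μ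
      ≤ ENNReal.ofReal (Real.exp (-l)) := by
  have hpos : Integrable (fun ω =>
      max (∑ i ∈ Finset.range n, (μ[A (i + 1) - A i | ℱ i]) ω - l) 0) μ :=
    ((integrable_compensator_partial_sum n).sub (integrable_const l)).pos_part
  rw [← ofReal_integral_eq_lintegral_ofReal hpos (ae_of_all _ fun ω => le_max_right _ _)]
  refine ENNReal.ofReal_le_ofReal
    (le_trans ?_ (integral_stop_loss_potential_le (μ := μ) hA hA0 hmono hbdd hl n))
  refine integral_mono hpos ((integrable_stop_loss_weight l n ((integrable_const 1).sub
    (integrable_of_adapted_of_mem_unit_interval hA hbdd n))).add hpos) fun ω => ?_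
  exact le_add_of_nonneg_left (mul_nonneg (sub_nonneg.2 (hbdd n ω).2) (Real.exp_pos _).le)

lemma tsum_lintegral_condExp_increment (hA : Adapted ℱ A) (hA0 : ∀ ω, A 0 ω = 0)
    (hmono : ∀ ω, Monotone fun n => A n ω) (hbdd : ∀ n ω, 0 ≤ A n ω ∧ A n ω ≤ 1)
    (hlim : ∀ᵐ ω ∂μ, Tendsto (fun n => A n ω) atTop (nhds 1)) :
    ∑' n, ∫⁻ ω, ENNReal.ofReal ((μ[A (n + 1) - A n | ℱ n]) ω) ∂μ = 1 := by
  have hi := integrable_of_adapted_of_mem_unit_interval (μ := μ) hA hbdd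
  have hterm : ∀ n, ∫⁻ ω, ENNReal.ofReal ((μ[A (n + 1) - A n | ℱ n]) ω) ∂μ =
      ENNReal.ofReal (∫ ω, A (n + 1) ω ∂μ - ∫ ω, A n ω ∂μ) := fun n => by
    rw [← ofReal_integral_eq_lintegral_ofReal integrable_condExp
      (condExp_increment_nonneg hmono n), integral_condExp (ℱ.le n)]
    exact congrArg _ (integral_sub (hi _) (hi _))
  have hnonneg : ∀ n, 0 ≤ ∫ ω, A (n + 1) ω ∂μ - ∫ ω, A n ω ∂μ := fun n =>
    sub_nonneg.2 (integral_mono (hi _) (hi _) fun ω => hmono ω n.le_succ)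
  have hconv : Tendsto (fun n => ∫ ω, A n ω ∂μ) atTop (nhds 1) := by
    have h := tendsto_integral_of_dominated_convergence (μ := μ) (F := A) (f := fun _ => 1)
      (fun _ => (1 : ℝ)) (fun n => (hi n).aestronglyMeasurable) (integrable_const 1)
      (fun n => ae_of_all _ fun ω => by
        rw [Real.norm_eq_abs, abs_of_nonneg (hbdd n ω).1]; exact (hbdd n ω).2) hlim
    simpa using h
  have hsum : HasSum (fun n => ∫ ω, A (n + 1) ω ∂μ - ∫ ω, A n ω ∂μ) 1 := by
    rw [hasSum_iff_tendsto_nat_of_nonneg hnonneg]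
    simpa [Finset.sum_range_sub (fun n => ∫ ω, A n ω ∂μ), hA0] using hconv
  simp_rw [hterm]
  rw [← ENNReal.ofReal_tsum_of_nonneg hnonneg hsum.summable, hsum.tsum_eq, ENNReal.ofReal_one]

end Compensator

/-- **Total risk, discrete-time compensator version: mean and stop-loss bounds.**
Let `A` be an adapted nondecreasing process with `A 0 = 0`, `0 ≤ A n ≤ 1`, and
`A n → 1` almost surely.  Let `R = ∑_{n=1}^∞ E[A n − A (n−1) | ℱ (n−1)]`.  Then
`E[R] = 1` and, for every real `λ > 0`, `E[(R − λ)⁺] ≤ e^{-λ}`.  Since `R ≥ 0` (a.e.)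
and `(R − λ)⁺ ≥ 0`, the expectations are expressed as lower Lebesgue integrals. -/
theorem total_risk_compensator_mean_and_stop_loss
    {Ω : Type*} {m : MeasurableSpace Ω} (μ : Measure Ω) [IsProbabilityMeasure μ]
    (ℱ : Filtration ℕ m) (A : ℕ → Ω → ℝ) (hA : Adapted ℱ A)
    (hA0 : ∀ ω, A 0 ω = 0)
    (hmono : ∀ ω, Monotone fun n => A n ω)
    (hbdd : ∀ n ω, 0 ≤ A n ω ∧ A n ω ≤ 1)
    (hlim : ∀ᵐ ω ∂μ, Tendsto (fun n => A n ω) atTop (nhds 1))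
    (R : Ω → ℝ)
    (hR : R = fun ω => ∑' n : ℕ, (μ[A (n + 1) - A n | ℱ n]) ω) :
    (∫⁻ ω, ENNReal.ofReal (R ω) ∂μ) = 1 ∧
      ∀ l : ℝ, 0 < l →
        (∫⁻ ω, ENNReal.ofReal (max (R ω - l) 0) ∂μ) ≤ ENNReal.ofReal (Real.exp (-l)) := by
  have htsum := tsum_lintegral_condExp_increment (μ := μ) hA hA0 hmono hbdd hlim
  have hmeas : ∀ n, AEMeasurable
      (fun ω => ENNReal.ofReal ((μ[A (n + 1) - A n | ℱ n]) ω)) μ :=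
    fun n => integrable_condExp.aemeasurable.ennreal_ofReal
  rw [← lintegral_tsum hmeas] at htsum
  have hnonneg : ∀ᵐ ω ∂μ, ∀ n, 0 ≤ (μ[A (n + 1) - A n | ℱ n]) ω :=
    ae_all_iff.2 fun n => condExp_increment_nonneg hmono n
  have hfin : ∀ᵐ ω ∂μ, ∑' n, ENNReal.ofReal ((μ[A (n + 1) - A n | ℱ n]) ω) < ∞ :=
    ae_lt_top' (AEMeasurable.tsum hmeas) (by rw [htsum]; exact ENNReal.one_ne_top)
  have hsummable : ∀ᵐ ω ∂μ, Summable fun n => (μ[A (n + 1) - A n | ℱ n]) ω := by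
    filter_upwards [hnonneg, hfin] with ω h0 h
    refine (ENNReal.summable_toReal h.ne).congr fun n => ?_
    exact ENNReal.toReal_ofReal (h0 n)
  subst hR
  refine ⟨?_, fun l hl => ?_⟩
  · rw [← htsum]
    refine lintegral_congr_ae ?_
    filter_upwards [hnonneg, hsummable] with ω h0 h
    exact ENNReal.ofReal_tsum_of_nonneg h0 h
  · let S : ℕ → Ω → ℝ≥0∞ := fun n ω => ENNReal.ofReal
      (max (∑ i ∈ Finset.range n, (μ[A (i + 1) - A i | ℱ i]) ω - l) 0)
    have hS : ∀ n, AEMeasurable (S n) μ := fun n =>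
      ((integrable_compensator_partial_sum n).sub
        (integrable_const l)).pos_part.aemeasurable.ennreal_ofReal
    calc _ = ∫⁻ ω, liminf (fun n => S n ω) atTop ∂μ := by
          refine lintegral_congr_ae ?_
          filter_upwards [hsummable] with ω h
          exact (ENNReal.tendsto_ofReal ((h.hasSum.tendsto_sum_nat.sub_const l).max
            tendsto_const_nhds)).liminf_eq.symm
      _ ≤ liminf (fun n => ∫⁻ ω, S n ω ∂μ) atTop := lintegral_liminf_le' hS
      _ ≤ liminf (fun _ => ENNReal.ofReal (Real.exp (-l))) (atTop : Filter ℕ) :=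
          liminf_le_liminf (Eventually.of_forall fun n =>
            lintegral_stop_loss_partial_sum_le hA hA0 hmono hbdd hl.le n)
      _ = _ := liminf_const _
end

section
/- Let (F_n)_{n≥0} be a filtration on a probability space (Ω, F, P), and let (A_n)_{n≥0} be an adapted process with A_0 = 0, A_n nondecreasing in n, and 0 ≤ A_n ≤ 1 for all n. Define B_n = Σ_{k=1}^n E[A_k − A_{k−1} | F_{k−1}] (with B_0 = 0) and M_n = e^{B_n} (1 − A_n). Then (M_n)_{n≥0} is a supermartingale with respect to (F_n): each M_n is integrable and E[M_{n+1} | F_n] ≤ M_n almost surely. -/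
open MeasureTheory Filter Set
open scoped ENNReal

theorem exp_mul_sub_le {a d : ℝ} (ha0 : 0 ≤ a) (ha1 : a ≤ 1) (hd : 0 ≤ d) :
    Real.exp d * (a - d) ≤ a := by
  have h : Real.exp d * (1 - d) ≤ 1 := by
    calc Real.exp d * (1 - d) ≤ Real.exp d * Real.exp (-d) := by
          gcongr
          exact Real.one_sub_le_exp_neg d
      _ = 1 := by rw [← Real.exp_add, add_neg_cancel, Real.exp_zero]
  calc Real.exp d * (a - d) ≤ Real.exp d * (a * (1 - d)) := by
        gcongr
        nlinarith
    _ = a * (Real.exp d * (1 - d)) := by ring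
    _ ≤ a := mul_le_of_le_one_right ha0 h

/-- **The supermartingale lemma, discrete time.**
Let `A` be an adapted process with `A 0 = 0`, `A n` nondecreasing in `n`, and
`0 ≤ A n ≤ 1`.  Let `B n = ∑_{k=1}^n E[A k − A (k−1) | ℱ (k−1)]` be the compensator of
`A` and `M n = e^{B n} (1 − A n)`.  Then `M` is a supermartingale with respect to `ℱ`
(in particular each `M n` is integrable and `E[M (n+1) | ℱ n] ≤ M n` a.s.). -/
theorem exp_compensator_supermartingale
    {Ω : Type*} {m : MeasurableSpace Ω} (μ : Measure Ω) [IsProbabilityMeasure μ]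
    (ℱ : Filtration ℕ m) (A : ℕ → Ω → ℝ) (hA : Adapted ℱ A)
    (hA0 : ∀ ω, A 0 ω = 0)
    (hmono : ∀ ω, Monotone fun n => A n ω)
    (hbdd : ∀ n ω, 0 ≤ A n ω ∧ A n ω ≤ 1)
    (B M : ℕ → Ω → ℝ)
    (hB : B = fun n ω => ∑ k ∈ Finset.range n, (μ[A (k + 1) - A k | ℱ k]) ω)
    (hM : M = fun n ω => Real.exp (B n ω) * (1 - A n ω)) :
    Supermartingale M ℱ μ := by
  have hAsm : ∀ n, StronglyMeasurable[ℱ n] (A n) := fun n => (hA n).stronglyMeasurable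
  have hAint : ∀ n, Integrable (A n) μ := fun n =>
    .of_bound ((hAsm n).mono (ℱ.le n)).aestronglyMeasurable 1 <| .of_forall fun ω => by
      rw [Real.norm_eq_abs, abs_of_nonneg (hbdd n ω).1]
      exact (hbdd n ω).2
  have hdint : ∀ n, Integrable (A (n + 1) - A n) μ := fun n => (hAint (n + 1)).sub (hAint n)
  have hd0 : ∀ n, 0 ≤ᵐ[μ] μ[A (n + 1) - A n | ℱ n] := fun n =>
    condExp_nonneg <| .of_forall fun ω => sub_nonneg.2 (hmono ω n.le_succ)
  have hd1 : ∀ n, μ[A (n + 1) - A n | ℱ n] ≤ᵐ[μ] fun _ => (1 : ℝ) := fun n => by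
    rw [← condExp_const (μ := μ) (ℱ.le n) (1 : ℝ)]
    refine condExp_mono (hdint n) (integrable_const 1) (.of_forall fun ω => ?_)
    have h0 := (hbdd n ω).1
    have h1 := (hbdd (n + 1) ω).2
    simp only [Pi.sub_apply]
    linarith
  have hBsucc : ∀ n ω, B (n + 1) ω = B n ω + (μ[A (n + 1) - A n | ℱ n]) ω := fun n ω => by
    simp only [hB, Finset.sum_range_succ]
  have hBpred : ∀ n, StronglyMeasurable[ℱ n] (B (n + 1)) := fun n => by
    rw [hB]
    exact Finset.stronglyMeasurable_fun_sum _ fun k hk =>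
      stronglyMeasurable_condExp.mono (ℱ.mono (Nat.lt_succ_iff.1 (Finset.mem_range.1 hk)))
  have hBsm : ∀ n, StronglyMeasurable[ℱ n] (B n) := fun n => by
    rw [hB]
    exact Finset.stronglyMeasurable_fun_sum _ fun k hk =>
      stronglyMeasurable_condExp.mono (ℱ.mono (Finset.mem_range.1 hk).le)
  have hexp_bound : ∀ n, ∀ᵐ ω ∂μ, ‖Real.exp (B n ω)‖ ≤ Real.exp n := fun n => by
    filter_upwards [ae_all_iff.2 hd1] with ω hω
    rw [Real.norm_eq_abs, Real.abs_exp, Real.exp_le_exp, hB]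
    calc ∑ k ∈ Finset.range n, (μ[A (k + 1) - A k | ℱ k]) ω
        ≤ ∑ _k ∈ Finset.range n, (1 : ℝ) := Finset.sum_le_sum fun k _ => hω k
      _ = n := by simp
  have hMadp : StronglyAdapted ℱ M := fun n => by
    rw [hM]
    exact (Real.continuous_exp.comp_stronglyMeasurable (hBsm n)).mul
      (stronglyMeasurable_const.sub (hAsm n))
  have hcint : ∀ n, Integrable (fun ω => 1 - A n ω) μ := fun n =>
    (integrable_const 1).sub (hAint n)
  have hMint : ∀ n, Integrable (M n) μ := fun n => by
    rw [hM]
    exact (hcint n).bdd_mul (Real.continuous_exp.comp_stronglyMeasurable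
      ((hBsm n).mono (ℱ.le n))).aestronglyMeasurable (hexp_bound n)
  refine supermartingale_nat hMadp hMint fun n => ?_
  have hpull : μ[M (n + 1) | ℱ n] =ᵐ[μ]
      (fun ω => Real.exp (B (n + 1) ω)) * μ[fun ω => 1 - A (n + 1) ω | ℱ n] := by
    rw [hM]
    exact condExp_stronglyMeasurable_mul_of_bound (ℱ.le n)
      (Real.continuous_exp.comp_stronglyMeasurable (hBpred n)) (hcint (n + 1)) _
      (hexp_bound (n + 1))
  have hcond : μ[fun ω => 1 - A (n + 1) ω | ℱ n] =ᵐ[μ]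
      (fun ω => 1 - A n ω) - μ[A (n + 1) - A n | ℱ n] := by
    have hsplit : (fun ω => 1 - A (n + 1) ω) = (fun ω => 1 - A n ω) - (A (n + 1) - A n) := by
      ext ω
      simp
    have hself : μ[fun ω => 1 - A n ω | ℱ n] = fun ω => 1 - A n ω :=
      condExp_of_stronglyMeasurable (ℱ.le n) (stronglyMeasurable_const.sub (hAsm n)) (hcint n)
    have hsub := condExp_sub (hcint n) (hdint n) (ℱ n)
    rwa [← hsplit, hself] at hsub
  filter_upwards [hpull, hcond, hd0 n] with ω hp hc hd
  rw [hp, Pi.mul_apply, hc, Pi.sub_apply, hBsucc, Real.exp_add, mul_assoc, hM]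
  have h0 := hbdd n ω
  exact mul_le_mul_of_nonneg_left
    (exp_mul_sub_le (by linarith) (by linarith) hd) (Real.exp_pos _).le
end

section
/- Let X and Y be integrable real random variables (possibly defined on different probability spaces). Then the following are equivalent: (i) for every convex function φ : ℝ → ℝ, E[φ(Y)] ≤ E[φ(X)] (both sides possibly infinite); (ii) E[Y] = E[X] and for every real λ, E[(Y − λ)^+] ≤ E[(X − λ)^+]. -/
open MeasureTheory Filter Set
open scoped ENNReal

namespace ConvexOrder

theorem exists_subgradient {φ : ℝ → ℝ} (hφ : ConvexOn ℝ univ φ) (x : ℝ) :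
    ∃ c, ∀ y, φ x + c * (y - x) ≤ φ y := by
  have hx : x ∈ interior (univ : Set ℝ) := by simp
  refine ⟨derivWithin φ (Ioi x) x, fun y => ?_⟩
  rcases lt_trichotomy x y with h | rfl | h
  · have := hφ.rightDeriv_le_slope_of_mem_interior hx (mem_univ y) h
    rw [slope_def_field, le_div_iff₀ (sub_pos.2 h)] at this
    linarith
  · simp
  · have := (hφ.slope_le_leftDeriv_of_mem_interior (mem_univ y) hx h).trans
      (hφ.leftDeriv_le_rightDeriv_of_mem_interior hx)
    rw [slope_def_field, div_le_iff₀ (sub_pos.2 h)] at this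
    linarith

theorem integral_le_integral_iff_lintegral {Ω₁ Ω₂ : Type*} {m₁ : MeasurableSpace Ω₁}
    {m₂ : MeasurableSpace Ω₂} {μ : Measure Ω₁} {ν : Measure Ω₂} {f : Ω₁ → ℝ} {g : Ω₂ → ℝ}
    (hf : Integrable f μ) (hg : Integrable g ν) :
    (∫ ω, f ω ∂μ) ≤ ∫ ω, g ω ∂ν ↔
      (∫⁻ ω, ENNReal.ofReal (f ω) ∂μ) + (∫⁻ ω, ENNReal.ofReal (-(g ω)) ∂ν)
        ≤ (∫⁻ ω, ENNReal.ofReal (g ω) ∂ν) + (∫⁻ ω, ENNReal.ofReal (-(f ω)) ∂μ) := by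
  have h1 := hf.lintegral_lt_top.ne
  have h2 := hf.neg.lintegral_lt_top.ne
  have h3 := hg.lintegral_lt_top.ne
  have h4 := hg.neg.lintegral_lt_top.ne
  simp only [Pi.neg_apply] at h2 h4
  rw [integral_eq_lintegral_pos_part_sub_lintegral_neg_part hf,
    integral_eq_lintegral_pos_part_sub_lintegral_neg_part hg,
    ← ENNReal.toReal_le_toReal (ENNReal.add_ne_top.2 ⟨h1, h4⟩) (ENNReal.add_ne_top.2 ⟨h3, h2⟩),
    ENNReal.toReal_add h1 h4, ENNReal.toReal_add h3 h2]
  constructor <;> intro h <;> linarith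

section

variable {Ω₁ Ω₂ : Type*} {m₁ : MeasurableSpace Ω₁} {m₂ : MeasurableSpace Ω₂}
  {μ : Measure Ω₁} {ν : Measure Ω₂} {Y : Ω₁ → ℝ} {X : Ω₂ → ℝ}

/-- The test function `f` is integrable along `Y` and `X`, and `E[f(Y)] ≤ E[f(X)]`. -/
def ExpectationLE (μ : Measure Ω₁) (ν : Measure Ω₂) (Y : Ω₁ → ℝ) (X : Ω₂ → ℝ)
    (f : ℝ → ℝ) : Prop :=
  Integrable (fun ω => f (Y ω)) μ ∧ Integrable (fun ω => f (X ω)) ν ∧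
    (∫ ω, f (Y ω) ∂μ) ≤ ∫ ω, f (X ω) ∂ν

theorem ExpectationLE.add {f g : ℝ → ℝ} (hf : ExpectationLE μ ν Y X f)
    (hg : ExpectationLE μ ν Y X g) : ExpectationLE μ ν Y X (fun x => f x + g x) := by
  refine ⟨hf.1.add hg.1, hf.2.1.add hg.2.1, ?_⟩
  rw [integral_add hf.1 hg.1, integral_add hf.2.1 hg.2.1]
  exact add_le_add hf.2.2 hg.2.2

theorem ExpectationLE.const_mul {f : ℝ → ℝ} (hf : ExpectationLE μ ν Y X f) {c : ℝ}
    (hc : 0 ≤ c) : ExpectationLE μ ν Y X (fun x => c * f x) := by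
  refine ⟨hf.1.const_mul c, hf.2.1.const_mul c, ?_⟩
  rw [integral_const_mul, integral_const_mul]
  exact mul_le_mul_of_nonneg_left hf.2.2 hc

variable [IsProbabilityMeasure μ] [IsProbabilityMeasure ν]

theorem expectationLE_const (k : ℝ) : ExpectationLE μ ν Y X (fun _ => k) :=
  ⟨integrable_const _, integrable_const _, by simp⟩

theorem expectationLE_affine (hY : Integrable Y μ) (hX : Integrable X ν)
    (hE : ∫ ω, Y ω ∂μ = ∫ ω, X ω ∂ν) (c d : ℝ) :
    ExpectationLE μ ν Y X (fun x => c * x + d) := by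
  refine ExpectationLE.add (f := fun x => c * x)
    ⟨hY.const_mul c, hX.const_mul c, ?_⟩ (expectationLE_const d)
  simp only [integral_const_mul, hE, le_refl]

theorem expectationLE_max_affine (hY : Integrable Y μ) (hX : Integrable X ν)
    (hSL : ∀ l : ℝ, (∫ ω, max (Y ω - l) 0 ∂μ) ≤ ∫ ω, max (X ω - l) 0 ∂ν)
    {c : ℝ} (hc : 0 ≤ c) (d : ℝ) :
    ExpectationLE μ ν Y X (fun x => max (c * x + d) 0) := by
  rcases hc.eq_or_lt with rfl | hc
  · simpa using expectationLE_const (μ := μ) (ν := ν) (Y := Y) (X := X) (max d 0)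
  · have h : ExpectationLE μ ν Y X (fun x => max (x - -d / c) 0) :=
      ⟨(hY.sub (integrable_const _)).pos_part, (hX.sub (integrable_const _)).pos_part, hSL _⟩
    convert h.const_mul hc.le using 2 with x
    rw [mul_max_of_nonneg _ _ hc.le]
    congr 1
    · field_simp
      ring
    · simp

/-- A finite maximum of tangent lines of a convex function has ordered expectations. -/
theorem expectationLE_sup'_tangent (hY : Integrable Y μ) (hX : Integrable X ν)
    (hE : ∫ ω, Y ω ∂μ = ∫ ω, X ω ∂ν)
    (hSL : ∀ l : ℝ, (∫ ω, max (Y ω - l) 0 ∂μ) ≤ ∫ ω, max (X ω - l) 0 ∂ν)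
    {φ s : ℝ → ℝ} (hs : ∀ x y, φ x + s x * (y - x) ≤ φ y) (t : Finset ℝ) (ht : t.Nonempty) :
    ExpectationLE μ ν Y X (fun x => t.sup' ht fun q => φ q + s q * (x - q)) := by
  have affine : ∀ q, ExpectationLE μ ν Y X (fun x => φ q + s q * (x - q)) := fun q => by
    convert expectationLE_affine hY hX hE (s q) (φ q - s q * q) using 2 with x
    ring
  induction t using Finset.induction_on_max with
  | empty => simp at ht
  | insert a t hlt ih =>
    rcases t.eq_empty_or_nonempty with rfl | hne
    · simpa using affine a
    · set b := t.max' hne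
      have hbt : b ∈ t := t.max'_mem hne
      have hba : b < a := hlt b hbt
      have hmono : s b ≤ s a := by nlinarith [hs b a, hs a b]
      have hmax := expectationLE_max_affine hY hX hSL (sub_nonneg.2 hmono)
        (φ a - s a * a - (φ b - s b * b))
      convert (ih hne).add hmax using 2 with x
      rw [Finset.sup'_insert hne]
      set F := t.sup' hne fun q => φ q + s q * (x - q)
      have hbF : φ b + s b * (x - b) ≤ F :=
        Finset.le_sup' (fun q => φ q + s q * (x - q)) hbt
      rcases le_total x b with hxb | hxb
      · have h1 : φ a + s a * (x - a) ≤ φ b + s b * (x - b) := by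
          nlinarith [hs a b, mul_nonneg (sub_nonneg.2 hmono) (sub_nonneg.2 hxb)]
        rw [sup_eq_right.2 (h1.trans hbF), max_eq_right (by linarith), add_zero]
      · have hFb : F = φ b + s b * (x - b) := by
          refine le_antisymm (Finset.sup'_le _ _ fun q hq => ?_) hbF
          have hqb : q ≤ b := t.le_max' q hq
          rcases hqb.eq_or_lt with rfl | hqb
          · exact le_rfl
          · have : s q ≤ s b := by nlinarith [hs b q, hs q b]
            nlinarith [hs q b, mul_nonneg (sub_nonneg.2 this) (sub_nonneg.2 hxb)]
        rw [hFb]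
        rcases le_total (φ a + s a * (x - a)) (φ b + s b * (x - b)) with h | h
        · rw [sup_eq_right.2 h, max_eq_right (by linarith), add_zero]
        · rw [sup_eq_left.2 h, max_eq_left (by linarith)]
          ring

end

/-- A convex function is approximated from below by its tangent lines at points of a dense set. -/
theorem exists_lt_tangent {φ s : ℝ → ℝ} (hφ : Continuous φ)
    (hs : ∀ x y, φ x + s x * (y - x) ≤ φ y) {D : Set ℝ} (hD : Dense D) {x c : ℝ}
    (hc : c < φ x) : ∃ q ∈ D, c < φ q + s q * (x - q) := by
  let g : ℝ → ℝ := fun q => φ q + s (x - 1) * (x - q)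
  have hg : Continuous g := by fun_prop
  have hnhds : ∀ᶠ q in nhds x, c < g q :=
    hg.continuousAt.eventually (lt_mem_nhds (by simpa [g] using hc))
  obtain ⟨l, hl, hlx⟩ := exists_Ioc_subset_of_mem_nhds hnhds ⟨x - 1, by linarith⟩
  obtain ⟨q, hqD, hq⟩ := hD.exists_between (max_lt hl (sub_one_lt x))
  have hq1 : x - 1 < q := (le_max_right _ _).trans_lt hq.1
  refine ⟨q, hqD, lt_of_lt_of_le (hlx ⟨(le_max_left _ _).trans_lt hq.1, hq.2.le⟩) ?_⟩
  have hmono : s (x - 1) ≤ s q := by nlinarith [hs (x - 1) q, hs q (x - 1)]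
  have := mul_le_mul_of_nonneg_right hmono (sub_nonneg.2 hq.2.le)
  simp only [g]
  linarith

section

variable {Ω₁ Ω₂ : Type*} {m₁ : MeasurableSpace Ω₁} {m₂ : MeasurableSpace Ω₂}
  {μ : Measure Ω₁} {ν : Measure Ω₂} [IsProbabilityMeasure μ] [IsProbabilityMeasure ν]
  {Y : Ω₁ → ℝ} {X : Ω₂ → ℝ}

theorem lintegral_sub_tangent_le (hY : Integrable Y μ) (hX : Integrable X ν)
    (hE : ∫ ω, Y ω ∂μ = ∫ ω, X ω ∂ν)
    (hSL : ∀ l : ℝ, (∫ ω, max (Y ω - l) 0 ∂μ) ≤ ∫ ω, max (X ω - l) 0 ∂ν)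
    {φ s : ℝ → ℝ} (hφ : Continuous φ) (hs : ∀ x y, φ x + s x * (y - x) ≤ φ y) :
    (∫⁻ ω, ENNReal.ofReal (φ (Y ω) - (φ 0 + s 0 * Y ω)) ∂μ) ≤
      ∫⁻ ω, ENNReal.ofReal (φ (X ω) - (φ 0 + s 0 * X ω)) ∂ν := by
  let t : ℕ → Finset ℝ := fun n =>
    insert 0 ((Finset.range n).image (TopologicalSpace.denseSeq ℝ))
  have ht : ∀ n, (t n).Nonempty := fun n => Finset.insert_nonempty _ _
  have htmono : Monotone t := fun m n h =>
    Finset.insert_subset_insert _ (Finset.image_subset_image (Finset.range_mono h))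
  let g : ℕ → ℝ → ℝ := fun n x =>
    ((t n).sup' (ht n) fun q => φ q + s q * (x - q)) - (φ 0 + s 0 * x)
  have hgLE : ∀ n, ExpectationLE μ ν Y X (g n) := fun n => by
    convert (expectationLE_sup'_tangent hY hX hE hSL hs (t n) (ht n)).add
      (expectationLE_affine hY hX hE (-s 0) (-φ 0)) using 2 with x
    simp only [g]
    ring
  have hg0 : ∀ n x, 0 ≤ g n x := fun n x => by
    have := Finset.le_sup' (fun q => φ q + s q * (x - q))
      (show (0 : ℝ) ∈ t n from Finset.mem_insert_self _ _)
    simp only [sub_zero] at this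
    simpa only [g, sub_nonneg] using this
  have hgle : ∀ n x, g n x ≤ φ x - (φ 0 + s 0 * x) := fun n x =>
    sub_le_sub_right (Finset.sup'_le _ _ fun q _ => hs q x) _
  have hgmono : ∀ x, Monotone fun n => g n x := fun x m n h =>
    sub_le_sub_right (Finset.sup'_mono _ (htmono h) (ht m)) _
  have hsup : ∀ x, ENNReal.ofReal (φ x - (φ 0 + s 0 * x)) ≤ ⨆ n, ENNReal.ofReal (g n x) := by
    intro x
    refine le_of_forall_lt fun c hc => ?_
    have hctop : c ≠ ⊤ := ne_top_of_lt hc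
    have hc' : c.toReal + (φ 0 + s 0 * x) < φ x := by
      have := (ENNReal.lt_ofReal_iff_toReal_lt hctop).1 hc
      linarith
    obtain ⟨_, ⟨k, rfl⟩, hk⟩ :=
      exists_lt_tangent hφ hs (TopologicalSpace.denseRange_denseSeq ℝ) hc'
    refine lt_of_lt_of_le ((ENNReal.lt_ofReal_iff_toReal_lt hctop).2 ?_)
      (le_iSup (fun n => ENNReal.ofReal (g n x)) (k + 1))
    have hmem : TopologicalSpace.denseSeq ℝ k ∈ t (k + 1) :=
      Finset.mem_insert_of_mem (Finset.mem_image_of_mem _ (by simp))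
    have := Finset.le_sup' (fun q => φ q + s q * (x - q)) hmem
    simp only [g]
    linarith
  calc (∫⁻ ω, ENNReal.ofReal (φ (Y ω) - (φ 0 + s 0 * Y ω)) ∂μ)
      ≤ ∫⁻ ω, ⨆ n, ENNReal.ofReal (g n (Y ω)) ∂μ := lintegral_mono fun ω => hsup _
    _ = ⨆ n, ∫⁻ ω, ENNReal.ofReal (g n (Y ω)) ∂μ :=
        lintegral_iSup' (fun n => (hgLE n).1.aemeasurable.ennreal_ofReal)
          (ae_of_all _ fun ω m n h => ENNReal.ofReal_le_ofReal (hgmono _ h))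
    _ ≤ ∫⁻ ω, ENNReal.ofReal (φ (X ω) - (φ 0 + s 0 * X ω)) ∂ν := by
        refine iSup_le fun n => ?_
        obtain ⟨h1, h2, h3⟩ := hgLE n
        rw [← ofReal_integral_eq_lintegral_ofReal h1 (ae_of_all _ fun ω => hg0 n _)]
        refine (ENNReal.ofReal_le_ofReal h3).trans ?_
        rw [ofReal_integral_eq_lintegral_ofReal h2 (ae_of_all _ fun ω => hg0 n _)]
        exact lintegral_mono fun ω => ENNReal.ofReal_le_ofReal (hgle n _)

theorem lintegral_convex_le (hY : Integrable Y μ) (hX : Integrable X ν)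
    (hE : ∫ ω, Y ω ∂μ = ∫ ω, X ω ∂ν)
    (hSL : ∀ l : ℝ, (∫ ω, max (Y ω - l) 0 ∂μ) ≤ ∫ ω, max (X ω - l) 0 ∂ν)
    {φ : ℝ → ℝ} (hφ : ConvexOn ℝ univ φ) :
    (∫⁻ ω, ENNReal.ofReal (φ (Y ω)) ∂μ) + (∫⁻ ω, ENNReal.ofReal (-(φ (X ω))) ∂ν)
      ≤ (∫⁻ ω, ENNReal.ofReal (φ (X ω)) ∂ν) + (∫⁻ ω, ENNReal.ofReal (-(φ (Y ω))) ∂μ) := by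
  have hcont : Continuous φ := continuousOn_univ.1 (hφ.continuousOn isOpen_univ)
  choose s hs using exists_subgradient hφ
  have hψ0 : ∀ x, 0 ≤ φ x - (φ 0 + s 0 * x) := fun x => by
    have := hs 0 x
    rw [sub_zero] at this
    linarith
  have hψ := lintegral_sub_tangent_le hY hX hE hSL hcont hs
  have hLY : Integrable (fun ω => φ 0 + s 0 * Y ω) μ := (integrable_const _).add (hY.const_mul _)
  have hLX : Integrable (fun ω => φ 0 + s 0 * X ω) ν := (integrable_const _).add (hX.const_mul _)
  by_cases htop : ∫⁻ ω, ENNReal.ofReal (φ (X ω)) ∂ν = ⊤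
  · simp [htop]
  have hψX : (∫⁻ ω, ENNReal.ofReal (φ (X ω) - (φ 0 + s 0 * X ω)) ∂ν) < ⊤ := by
    refine lt_of_le_of_lt (b := (∫⁻ ω, ENNReal.ofReal (φ (X ω)) ∂ν) +
      ∫⁻ ω, ENNReal.ofReal (-(φ 0 + s 0 * X ω)) ∂ν) ?_
      (ENNReal.add_lt_top.2 ⟨lt_top_iff_ne_top.2 htop, hLX.neg.lintegral_lt_top⟩)
    have hneg : AEMeasurable (fun ω => ENNReal.ofReal (-(φ 0 + s 0 * X ω))) ν :=
      hLX.neg.aemeasurable.ennreal_ofReal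
    rw [← lintegral_add_right' _ hneg]
    exact lintegral_mono fun ω => by rw [sub_eq_add_neg]; exact ENNReal.ofReal_add_le
  have hiX : Integrable (fun ω => φ (X ω) - (φ 0 + s 0 * X ω)) ν :=
    (lintegral_ofReal_ne_top_iff_integrable
      ((hcont.comp_aestronglyMeasurable hX.1).sub hLX.1) (ae_of_all _ fun ω => hψ0 _)).1 hψX.ne
  have hiY : Integrable (fun ω => φ (Y ω) - (φ 0 + s 0 * Y ω)) μ :=
    (lintegral_ofReal_ne_top_iff_integrable
      ((hcont.comp_aestronglyMeasurable hY.1).sub hLY.1) (ae_of_all _ fun ω => hψ0 _)).1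
      (hψ.trans_lt hψX).ne
  have hφX : Integrable (fun ω => φ (X ω)) ν := by
    simpa [Pi.add_def] using hiX.add hLX
  have hφY : Integrable (fun ω => φ (Y ω)) μ := by
    simpa [Pi.add_def] using hiY.add hLY
  rw [← integral_le_integral_iff_lintegral hφY hφX]
  rw [← ofReal_integral_eq_lintegral_ofReal hiY (ae_of_all _ fun ω => hψ0 _),
    ← ofReal_integral_eq_lintegral_ofReal hiX (ae_of_all _ fun ω => hψ0 _),
    ENNReal.ofReal_le_ofReal_iff (integral_nonneg fun ω => hψ0 _),
    integral_sub hφY hLY, integral_sub hφX hLX, integral_add (integrable_const _) (hY.const_mul _),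
    integral_add (integrable_const _) (hX.const_mul _)] at hψ
  simp only [integral_const_mul, hE, integral_const, probReal_univ] at hψ
  linarith

end

end ConvexOrder

/-- **Characterization of the convex order.**
Let `X` and `Y` be integrable real random variables, possibly on different probability
spaces.  Then `E[φ(Y)] ≤ E[φ(X)]` for every convex `φ : ℝ → ℝ` (both sides possibly
infinite) if and only if `E[Y] = E[X]` and `E[(Y − λ)⁺] ≤ E[(X − λ)⁺]` for every real
`λ`.  The inequality of possibly-infinite expectations `E[f] ≤ E[g]` is encoded as
`E[f⁺] + E[g⁻] ≤ E[g⁺] + E[f⁻]` using lower Lebesgue integrals. -/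
theorem convex_order_iff_mean_eq_and_stop_loss
    {Ω₁ Ω₂ : Type*} {m₁ : MeasurableSpace Ω₁} {m₂ : MeasurableSpace Ω₂}
    (μ : Measure Ω₁) (ν : Measure Ω₂) [IsProbabilityMeasure μ] [IsProbabilityMeasure ν]
    (Y : Ω₁ → ℝ) (X : Ω₂ → ℝ) (hY : Integrable Y μ) (hX : Integrable X ν) :
    (∀ φ : ℝ → ℝ, ConvexOn ℝ Set.univ φ →
        (∫⁻ ω, ENNReal.ofReal (φ (Y ω)) ∂μ) + (∫⁻ ω, ENNReal.ofReal (-(φ (X ω))) ∂ν)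
          ≤ (∫⁻ ω, ENNReal.ofReal (φ (X ω)) ∂ν) + (∫⁻ ω, ENNReal.ofReal (-(φ (Y ω))) ∂μ))
      ↔ ((∫ ω, Y ω ∂μ) = ∫ ω, X ω ∂ν ∧
          ∀ l : ℝ, (∫ ω, max (Y ω - l) 0 ∂μ) ≤ ∫ ω, max (X ω - l) 0 ∂ν) := by
  constructor
  · intro h
    refine ⟨le_antisymm ?_ ?_, fun l => ?_⟩
    · exact (ConvexOrder.integral_le_integral_iff_lintegral hY hX).2
        (h id (convexOn_id convex_univ))
    · have := (ConvexOrder.integral_le_integral_iff_lintegral hY.neg hX.neg).2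
        (h (fun x => -x) (concaveOn_id convex_univ).neg)
      simp only [Pi.neg_apply, integral_neg] at this
      linarith
    · exact (ConvexOrder.integral_le_integral_iff_lintegral
        (hY.sub (integrable_const l)).pos_part (hX.sub (integrable_const l)).pos_part).2
        (h (fun x => max (x - l) 0)
          (((convexOn_id convex_univ).sub (concaveOn_const l convex_univ)).sup
            (convexOn_const 0 convex_univ)))
  · rintro ⟨hE, hSL⟩ φ hφ
    exact ConvexOrder.lintegral_convex_le hY hX hE hSL hφ
end

section
/- Let (F_n)_{n≥0} be a filtration on a probability space (Ω, F, P) and let Z_1, …, Z_K be random variables taking values in the positive integers together with the symbol ∞. Define W = Σ_{j=1}^K Σ_{n=1}^∞ P(Z_j = n | F_{n−1}). Then for every real λ > 0, P(W ≥ λK) ≤ e^{1−λ}. -/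
open MeasureTheory Filter Set
open scoped ENNReal

/-- `truncExp c` is the derivative of the convex function `x ↦ truncExp c x + max (x - c) 0`,
and so solves `φ - φ' = max (· - c) 0`. -/
noncomputable def truncExp (c x : ℝ) : ℝ := Real.exp (min (x - c) 0)

lemma truncExp_nonneg (c x : ℝ) : 0 ≤ truncExp c x := (Real.exp_pos _).le

lemma truncExp_le_one (c x : ℝ) : truncExp c x ≤ 1 :=
  Real.exp_le_one_iff.2 (min_le_right _ _)

lemma truncExp_mono (c : ℝ) : Monotone (truncExp c) := fun _ _ h =>
  Real.exp_le_exp.2 (min_le_min_right _ (sub_le_sub_right h c))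

lemma continuous_truncExp (c : ℝ) : Continuous (truncExp c) := by
  unfold truncExp
  fun_prop

lemma truncExp_zero {c : ℝ} (hc : 0 ≤ c) : truncExp c 0 = Real.exp (-c) := by
  simp [truncExp, hc]

lemma truncExp_add_max_le {a b : ℝ} (c : ℝ) (hab : a ≤ b) :
    truncExp c b + max (b - c) 0 ≤
      truncExp c a + max (a - c) 0 + truncExp c b * (b - a) := by
  unfold truncExp
  rcases le_total b c with hb | hb
  · rw [min_eq_left (by linarith : b - c ≤ 0), min_eq_left (by linarith : a - c ≤ 0),
      max_eq_right (by linarith : b - c ≤ 0), max_eq_right (by linarith : a - c ≤ 0)]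
    have h := mul_le_mul_of_nonneg_left (Real.add_one_le_exp (a - b)) (Real.exp_pos (b - c)).le
    rw [← Real.exp_add] at h
    ring_nf at h ⊢
    linarith
  · rw [min_eq_right (by linarith : 0 ≤ b - c), max_eq_left (by linarith : 0 ≤ b - c)]
    rcases le_total a c with ha | ha
    · rw [min_eq_left (by linarith : a - c ≤ 0), max_eq_right (by linarith : a - c ≤ 0)]
      have h := Real.add_one_le_exp (a - c)
      simp only [Real.exp_zero]
      linarith
    · rw [min_eq_right (by linarith : 0 ≤ a - c), max_eq_left (by linarith : 0 ≤ a - c)]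
      simp only [Real.exp_zero]
      linarith

section ConditionalRisk

variable {Ω : Type*} {m : MeasurableSpace Ω}

/-- The conditional risk of the events `A 0, …, A (N - 1)` along the filtration `ℱ`. -/
noncomputable def condRisk (μ : Measure Ω) (ℱ : Filtration ℕ m) (A : ℕ → Set Ω) (N : ℕ) (ω : Ω) :
    ℝ :=
  ∑ n ∈ Finset.range N, (μ[(A n).indicator (fun _ => (1 : ℝ)) | ℱ n]) ω

variable (μ : Measure Ω) (ℱ : Filtration ℕ m) (A : ℕ → Set Ω)

lemma condRisk_succ (N : ℕ) (ω : Ω) : condRisk μ ℱ A (N + 1) ω =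
    condRisk μ ℱ A N ω + (μ[(A N).indicator (fun _ => (1 : ℝ)) | ℱ N]) ω :=
  Finset.sum_range_succ _ _

lemma stronglyMeasurable_condRisk_succ (N : ℕ) :
    StronglyMeasurable[ℱ N] (condRisk μ ℱ A (N + 1)) :=
  Finset.stronglyMeasurable_fun_sum _ fun _ hn =>
    stronglyMeasurable_condExp.mono (ℱ.mono (Nat.lt_succ_iff.1 (Finset.mem_range.1 hn)))

lemma measurable_condRisk (N : ℕ) : Measurable (condRisk μ ℱ A N) :=
  Finset.measurable_fun_sum _ fun n _ => (stronglyMeasurable_condExp.mono (ℱ.le n)).measurable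

lemma integrable_condRisk (N : ℕ) : Integrable (condRisk μ ℱ A N) μ :=
  integrable_finsetSum _ fun _ _ => integrable_condExp

lemma condRisk_monotone : ∀ᵐ ω ∂μ, Monotone fun N => condRisk μ ℱ A N ω := by
  have h : ∀ᵐ ω ∂μ, ∀ n, 0 ≤ (μ[(A n).indicator (fun _ => (1 : ℝ)) | ℱ n]) ω :=
    ae_all_iff.2 fun _ => condExp_nonneg <| Eventually.of_forall fun ω =>
      indicator_nonneg (fun _ _ => zero_le_one) ω
  filter_upwards [h] with ω hω
  refine monotone_nat_of_le_succ fun N => ?_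
  rw [condRisk_succ]
  exact le_add_of_nonneg_right (hω N)

variable [IsProbabilityMeasure μ]

lemma integrable_truncExp_comp (c : ℝ) {f : Ω → ℝ} (hf : Measurable f) :
    Integrable (fun ω => truncExp c (f ω)) μ :=
  Integrable.of_bound ((continuous_truncExp c).measurable.comp hf).aestronglyMeasurable 1 <|
    Eventually.of_forall fun _ => by
      rw [Real.norm_of_nonneg (truncExp_nonneg _ _)]
      exact truncExp_le_one _ _

variable {A} (hA : ∀ n, MeasurableSet (A n))
include hA

lemma integral_truncExp_mul_condExp (c : ℝ) (N : ℕ) :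
    Integrable (fun ω => truncExp c (condRisk μ ℱ A (N + 1) ω) *
      (μ[(A N).indicator (fun _ => (1 : ℝ)) | ℱ N]) ω) μ ∧
    ∫ ω, truncExp c (condRisk μ ℱ A (N + 1) ω) *
      (μ[(A N).indicator (fun _ => (1 : ℝ)) | ℱ N]) ω ∂μ =
    ∫ ω, truncExp c (condRisk μ ℱ A (N + 1) ω) * (A N).indicator (fun _ => (1 : ℝ)) ω ∂μ := by
  have hsm : StronglyMeasurable[ℱ N] fun ω => truncExp c (condRisk μ ℱ A (N + 1) ω) :=
    (continuous_truncExp c).comp_stronglyMeasurable (stronglyMeasurable_condRisk_succ μ ℱ A N)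
  have hbound : ∀ ω, ‖truncExp c (condRisk μ ℱ A (N + 1) ω)‖ ≤ 1 := fun ω => by
    rw [Real.norm_of_nonneg (truncExp_nonneg _ _)]
    exact truncExp_le_one _ _
  have hind : Integrable ((A N).indicator fun _ => (1 : ℝ)) μ :=
    (integrable_const _).indicator (hA N)
  have hmul : ∀ {g : Ω → ℝ}, Integrable g μ →
      Integrable (fun ω => truncExp c (condRisk μ ℱ A (N + 1) ω) * g ω) μ := fun hg =>
    hg.bdd_mul (hsm.mono (ℱ.le N)).aestronglyMeasurable (Eventually.of_forall hbound)
  refine ⟨hmul integrable_condExp, ?_⟩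
  rw [← integral_condExp (ℱ.le N) (f := fun ω => truncExp c (condRisk μ ℱ A (N + 1) ω) *
    (A N).indicator (fun _ => (1 : ℝ)) ω)]
  exact (integral_congr_ae
    (condExp_mul_of_stronglyMeasurable_left hsm (hmul hind) hind)).symm

lemma integral_truncExp_add_max_le (c : ℝ) (N : ℕ) :
    ∫ ω, (truncExp c (condRisk μ ℱ A N ω) + max (condRisk μ ℱ A N ω - c) 0) ∂μ ≤
      truncExp c 0 + max (0 - c) 0 + ∑ n ∈ Finset.range N,
        ∫ ω, truncExp c (condRisk μ ℱ A (n + 1) ω) * (A n).indicator (fun _ => (1 : ℝ)) ω ∂μ := by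
  have hint : ∀ N, Integrable (fun ω => truncExp c (condRisk μ ℱ A N ω) +
      max (condRisk μ ℱ A N ω - c) 0) μ := fun N =>
    (integrable_truncExp_comp μ c (measurable_condRisk μ ℱ A N)).add
      ((integrable_condRisk μ ℱ A N).sub (integrable_const c)).pos_part
  induction N with
  | zero => simp [condRisk]
  | succ N ih =>
    obtain ⟨hi, he⟩ := integral_truncExp_mul_condExp μ ℱ hA c N
    rw [Finset.sum_range_succ, ← he, ← add_assoc]
    refine le_trans ?_ (add_le_add_left ih _)
    rw [← integral_add (hint N) hi]
    refine integral_mono_ae (hint _) ((hint N).add hi) ?_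
    filter_upwards [condRisk_monotone μ ℱ A] with ω hω
    have h := truncExp_add_max_le c (hω N.le_succ)
    simp only [Nat.succ_eq_add_one] at h
    rwa [show condRisk μ ℱ A (N + 1) ω - condRisk μ ℱ A N ω = _ from
      sub_eq_of_eq_add' (condRisk_succ μ ℱ A N ω)] at h

variable (hdisj : Pairwise fun i j => Disjoint (A i) (A j))
include hdisj

lemma sum_integral_truncExp_le (c : ℝ) (N : ℕ) :
    ∑ n ∈ Finset.range N,
        ∫ ω, truncExp c (condRisk μ ℱ A (n + 1) ω) * (A n).indicator (fun _ => (1 : ℝ)) ω ∂μ ≤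
      ∫ ω, truncExp c (condRisk μ ℱ A N ω) ∂μ := by
  have hi : ∀ n, Integrable (fun ω => truncExp c (condRisk μ ℱ A (n + 1) ω) *
      (A n).indicator (fun _ => (1 : ℝ)) ω) μ := fun n =>
    ((integrable_truncExp_comp μ c (measurable_condRisk μ ℱ A (n + 1))).indicator (hA n)).congr <|
      Eventually.of_forall fun ω => by by_cases h : ω ∈ A n <;> simp [h]
  rw [← integral_finsetSum _ fun n _ => hi n]
  refine integral_mono_ae (integrable_finsetSum _ fun n _ => hi n)
    (integrable_truncExp_comp μ c (measurable_condRisk μ ℱ A N)) ?_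
  filter_upwards [condRisk_monotone μ ℱ A] with ω hω
  by_cases h : ∃ k ∈ Finset.range N, ω ∈ A k
  · obtain ⟨k, hk, hωk⟩ := h
    rw [Finset.sum_eq_single_of_mem k hk fun n _ hn => by
      simp [disjoint_left.1 (hdisj hn.symm) hωk]]
    simpa [hωk] using truncExp_mono c (hω (Nat.succ_le_of_lt (Finset.mem_range.1 hk)))
  · push Not at h
    rw [Finset.sum_eq_zero fun n hn => by simp [h n hn]]
    exact truncExp_nonneg _ _

lemma lintegral_condRisk_sub_le {c : ℝ} (hc : 0 ≤ c) (N : ℕ) :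
    ∫⁻ ω, ENNReal.ofReal (condRisk μ ℱ A N ω - c) ∂μ ≤ ENNReal.ofReal (Real.exp (-c)) := by
  have hi : Integrable (fun ω => max (condRisk μ ℱ A N ω - c) 0) μ :=
    ((integrable_condRisk μ ℱ A N).sub (integrable_const c)).pos_part
  have h := (integral_truncExp_add_max_le μ ℱ hA c N).trans
    (add_le_add_right (sum_integral_truncExp_le μ ℱ hA hdisj c N) _)
  rw [integral_add (integrable_truncExp_comp μ c (measurable_condRisk μ ℱ A N)) hi,
    truncExp_zero hc, max_eq_right (by linarith)] at h
  calc ∫⁻ ω, ENNReal.ofReal (condRisk μ ℱ A N ω - c) ∂μ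
      = ∫⁻ ω, ENNReal.ofReal (max (condRisk μ ℱ A N ω - c) 0) ∂μ := by simp
    _ = ENNReal.ofReal (∫ ω, max (condRisk μ ℱ A N ω - c) 0 ∂μ) :=
      (ofReal_integral_eq_lintegral_ofReal hi
        (Eventually.of_forall fun _ => le_max_right _ _)).symm
    _ ≤ _ := ENNReal.ofReal_le_ofReal (by linarith)

lemma lintegral_liminf_condRisk_sub_le {c : ℝ} (hc : 0 ≤ c) :
    ∫⁻ ω, liminf (fun N => ENNReal.ofReal (condRisk μ ℱ A N ω - c)) atTop ∂μ ≤
      ENNReal.ofReal (Real.exp (-c)) :=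
  (lintegral_liminf_le fun N => ((measurable_condRisk μ ℱ A N).sub_const c).ennreal_ofReal).trans <|
    (liminf_le_liminf (Eventually.of_forall fun N =>
      lintegral_condRisk_sub_le μ ℱ hA hdisj hc N)).trans (liminf_const _).le

end ConditionalRisk

lemma ofReal_tsum_sub_le_liminf (f : ℕ → ℝ) {c : ℝ} (hc : 0 ≤ c) :
    ENNReal.ofReal (∑' n, f n - c) ≤
      liminf (fun N => ENNReal.ofReal (∑ n ∈ Finset.range N, f n - c)) atTop := by
  by_cases hf : Summable f
  · exact (ENNReal.tendsto_ofReal (hf.hasSum.tendsto_sum_nat.sub_const c)).liminf_eq.ge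
  · rw [tsum_eq_zero_of_not_summable hf, ENNReal.ofReal_of_nonpos (by linarith)]
    exact zero_le

/-- **Tail bound for the total conditional risk of `K` random times.**
Let `ℱ` be a filtration and `Z 1, …, Z K` random variables with values in the positive
integers together with `∞` (modelled by `ℕ∞`).  Let
`W = ∑_{j=1}^K ∑_{n=1}^∞ P(Z j = n | ℱ (n−1))`.  Then for every real `λ > 0`,
`P(W ≥ λ K) ≤ e^{1−λ}`. -/
theorem total_risk_sum_tail_bound
    {Ω : Type*} {m : MeasurableSpace Ω} (μ : Measure Ω) [IsProbabilityMeasure μ]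
    (ℱ : Filtration ℕ m) (K : ℕ) (hK : 0 < K) (Z : Fin K → Ω → ℕ∞)
    (hZmeas : ∀ j : Fin K, ∀ n : ℕ∞, MeasurableSet {ω | Z j ω = n})
    (hZpos : ∀ (j : Fin K) ω, Z j ω ≠ 0)
    (W : Ω → ℝ)
    (hW : W = fun ω => ∑ j : Fin K, ∑' n : ℕ,
      (μ[Set.indicator {ω' | Z j ω' = ((n + 1 : ℕ) : ℕ∞)} (fun _ => (1 : ℝ)) | ℱ n]) ω) :
    ∀ l : ℝ, 0 < l →
      μ {ω | l * (K : ℝ) ≤ W ω} ≤ ENNReal.ofReal (Real.exp (1 - l)) := by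
  subst hW
  intro l _
  rcases le_total l 1 with hl | hl
  · refine prob_le_one.trans ?_
    rw [← ENNReal.ofReal_one]
    exact ENNReal.ofReal_le_ofReal (Real.one_le_exp (by linarith))
  have hc : 0 ≤ l - 1 := by linarith
  set A : Fin K → ℕ → Set Ω := fun j n => {ω' | Z j ω' = ((n + 1 : ℕ) : ℕ∞)}
  have hA : ∀ j n, MeasurableSet (A j n) := fun j n => hZmeas j _
  have hdisj : ∀ j, Pairwise fun i k => Disjoint (A j i) (A j k) := fun j i k hik =>
    disjoint_left.2 fun ω hi hk => hik <| by
      have h : ((i + 1 : ℕ) : ℕ∞) = ((k + 1 : ℕ) : ℕ∞) := hi.symm.trans hk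
      exact Nat.succ_injective (Nat.cast_injective h)
  set g : Fin K → Ω → ℝ≥0∞ := fun j ω =>
    liminf (fun N => ENNReal.ofReal (condRisk μ ℱ (A j) N ω - (l - 1))) atTop
  have hg : ∀ j, Measurable (g j) := fun j => Measurable.liminf fun N =>
    ((measurable_condRisk μ ℱ (A j) N).sub_const _).ennreal_ofReal
  have hint : ∫⁻ ω, ∑ j, g j ω ∂μ ≤ K * ENNReal.ofReal (Real.exp (1 - l)) := by
    rw [lintegral_finsetSum _ fun j _ => hg j]
    refine (Finset.sum_le_sum fun j _ =>
      lintegral_liminf_condRisk_sub_le μ ℱ (hA j) (hdisj j) hc).trans ?_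
    simp
  refine (measure_mono (t := {ω | (K : ℝ≥0∞) ≤ ∑ j, g j ω}) fun ω hω => ?_).trans ?_
  · calc (K : ℝ≥0∞) = ENNReal.ofReal (l * K - K * (l - 1)) := by
          rw [show l * K - K * (l - 1) = (K : ℝ) by ring, ENNReal.ofReal_natCast]
      _ ≤ ENNReal.ofReal (∑ j : Fin K, (∑' n : ℕ,
          (μ[(A j n).indicator (fun _ => (1 : ℝ)) | ℱ n]) ω - (l - 1))) := by
          refine ENNReal.ofReal_le_ofReal ?_
          rw [Finset.sum_sub_distrib, Finset.sum_const, Finset.card_univ, Fintype.card_fin,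
            nsmul_eq_mul]
          exact sub_le_sub_right hω _
      _ ≤ ∑ j : Fin K, ENNReal.ofReal (∑' n : ℕ,
          (μ[(A j n).indicator (fun _ => (1 : ℝ)) | ℱ n]) ω - (l - 1)) :=
          Finset.le_sum_of_subadditive _ ENNReal.ofReal_zero.le
            (fun _ _ => ENNReal.ofReal_add_le) _ _
      _ ≤ ∑ j, g j ω := Finset.sum_le_sum fun j _ => ofReal_tsum_sub_le_liminf _ hc
  · have hK0 : (K : ℝ≥0∞) ≠ 0 := by exact_mod_cast hK.ne'
    refine (ENNReal.mul_le_mul_iff_right hK0 (ENNReal.natCast_ne_top K)).1 ?_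
    exact (mul_meas_ge_le_lintegral (Finset.measurable_fun_sum _ fun j _ => hg j) _).trans hint
end
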